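/- arXiv:2008.03598 — 3 statements merged into one kernel-verified Lean document; each statement's English description precedes it below -/
import Mathlib

section
/- The function L is real-analytic on ℝ and strictly increasing (its derivative is everywhere positive); moreover L(0) = π/3 and L(ω) → 0 as ω → −∞. -/
open Real Complex Filter

/-- `A₊(z) = e^{-iπ/3} Ai(e^{-iπ/3} z)`. -/
noncomputable def Aplus (Ai : ℂ → ℂ) (z : ℂ) : ℂ :=
  Complex.exp (-(Real.pi / 3 : ℂ) * Complex.I) * Ai (Complex.exp (-(Real.pi / 3 : ℂ) * Complex.I) * z)

/-- `A₋(z) = e^{iπ/3} Ai(e^{iπ/3} z)`. -/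
noncomputable def Aminus (Ai : ℂ → ℂ) (z : ℂ) : ℂ :=
  Complex.exp ((Real.pi / 3 : ℂ) * Complex.I) * Ai (Complex.exp ((Real.pi / 3 : ℂ) * Complex.I) * z)

/-- The moments `∫₀^∞ tᵖ exp(-t³/3 - x³/(3t³)) dt`; up to constants, the cases `p = 0, 1` are `Ai`
and `-Ai'` on the nonnegative half-line. -/
noncomputable def airyMoment (p : ℕ) (x : ℝ) : ℝ :=
  ∫ t in Set.Ioi (0 : ℝ), t ^ p * rexp (-(t ^ 3 / 3) - x ^ 3 / (3 * t ^ 3))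

theorem integrableOn_pow_mul_exp_neg_cube (p : ℕ) :
    MeasureTheory.IntegrableOn (fun t : ℝ => t ^ p * rexp (-(t ^ 3 / 3))) (Set.Ioi 0) := by
  have h := integrableOn_rpow_mul_exp_neg_mul_rpow (p := 3) (s := p) (b := 1 / 3)
    (by have : (0 : ℝ) ≤ p := p.cast_nonneg
        linarith) (by norm_num) (by norm_num)
  refine h.congr_fun (fun t _ => ?_) measurableSet_Ioi
  have h3 : t ^ (3 : ℝ) = t ^ 3 := by exact_mod_cast Real.rpow_natCast t 3
  simp only [Real.rpow_natCast, h3]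
  ring_nf

theorem airyMoment_zero (p : ℕ) :
    airyMoment p 0 = (1 / 3) ^ (-((p : ℝ) + 1) / 3) * (1 / 3) * Real.Gamma ((p + 1) / 3) := by
  rw [← _root_.integral_rpow_mul_exp_neg_mul_rpow (p := 3) (q := p) (b := 1 / 3) (by norm_num)
    (by have : (0 : ℝ) ≤ p := p.cast_nonneg
        linarith) (by norm_num)]
  refine MeasureTheory.setIntegral_congr_fun measurableSet_Ioi (fun t _ => ?_)
  have h3 : t ^ (3 : ℝ) = t ^ 3 := by exact_mod_cast Real.rpow_natCast t 3
  simp only [Real.rpow_natCast, h3]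
  ring_nf

theorem measurable_airyMoment_integrand (p : ℕ) (x : ℝ) :
    Measurable (fun t : ℝ => t ^ p * rexp (-(t ^ 3 / 3) - x ^ 3 / (3 * t ^ 3))) := by
  fun_prop

theorem airyMoment_integrand_le (p : ℕ) {x t : ℝ} (hx : 0 ≤ x) (ht : 0 < t) :
    t ^ p * rexp (-(t ^ 3 / 3) - x ^ 3 / (3 * t ^ 3)) ≤ t ^ p * rexp (-(t ^ 3 / 3)) := by
  have : 0 ≤ x ^ 3 / (3 * t ^ 3) := by positivity
  gcongr
  linarith

theorem norm_airyMoment_integrand_le (p : ℕ) {x t : ℝ} (hx : 0 ≤ x) (ht : 0 < t) :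
    ‖t ^ p * rexp (-(t ^ 3 / 3) - x ^ 3 / (3 * t ^ 3))‖ ≤ t ^ p * rexp (-(t ^ 3 / 3)) := by
  rw [Real.norm_of_nonneg (by positivity)]
  exact airyMoment_integrand_le p hx ht

theorem integrableOn_airyMoment_integrand (p : ℕ) {x : ℝ} (hx : 0 ≤ x) :
    MeasureTheory.IntegrableOn
      (fun t : ℝ => t ^ p * rexp (-(t ^ 3 / 3) - x ^ 3 / (3 * t ^ 3))) (Set.Ioi 0) :=
  (integrableOn_pow_mul_exp_neg_cube p).mono'
    (measurable_airyMoment_integrand p x).aestronglyMeasurable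
    ((MeasureTheory.ae_restrict_mem measurableSet_Ioi).mono
      fun _ ht => norm_airyMoment_integrand_le p hx ht)

theorem continuousOn_airyMoment (p : ℕ) : ContinuousOn (airyMoment p) (Set.Ici 0) := by
  refine MeasureTheory.continuousOn_of_dominated
    (fun x _ => (measurable_airyMoment_integrand p x).aestronglyMeasurable)
    (fun x hx => (MeasureTheory.ae_restrict_mem measurableSet_Ioi).mono
      fun t ht => norm_airyMoment_integrand_le p hx ht)
    (integrableOn_pow_mul_exp_neg_cube p) (.of_forall fun t => ?_)
  fun_prop

theorem airyMoment_pos (p : ℕ) {x : ℝ} (hx : 0 ≤ x) : 0 < airyMoment p x := by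
  unfold airyMoment
  rw [MeasureTheory.setIntegral_pos_iff_support_of_nonneg_ae
    ((MeasureTheory.ae_restrict_mem measurableSet_Ioi).mono fun t (ht : 0 < t) => by
      simp only [Pi.zero_apply]; positivity)
    (integrableOn_airyMoment_integrand p hx)]
  refine lt_of_lt_of_le ?_ (MeasureTheory.measure_mono (s := Set.Ioi (0 : ℝ)) ?_)
  · simp
  · intro t (ht : 0 < t)
    refine ⟨?_, ht⟩
    simp only [Function.mem_support]
    positivity

theorem airyMoment_le_airyMoment_zero (p : ℕ) {x : ℝ} (hx : 0 ≤ x) :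
    airyMoment p x ≤ airyMoment p 0 := by
  refine MeasureTheory.setIntegral_mono_on (integrableOn_airyMoment_integrand p hx)
    (integrableOn_airyMoment_integrand p le_rfl) measurableSet_Ioi fun t ht => ?_
  simpa using airyMoment_integrand_le p hx ht

theorem integral_Ioi_comp_div {x : ℝ} (hx : 0 < x) (g : ℝ → ℝ) :
    ∫ t in Set.Ioi (0 : ℝ), g t = ∫ s in Set.Ioi (0 : ℝ), x / s ^ 2 * g (x / s) := by
  have himage : (fun s : ℝ => x / s) '' Set.Ioi 0 = Set.Ioi 0 := by
    ext t
    constructor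
    · rintro ⟨s, hs : 0 < s, rfl⟩
      exact div_pos hx hs
    · intro (ht : 0 < t)
      exact ⟨x / t, div_pos hx ht, by field_simp⟩
  have h := MeasureTheory.integral_image_eq_integral_abs_deriv_smul (s := Set.Ioi (0 : ℝ))
    (f := fun s => x / s) (f' := fun s => -(x / s ^ 2)) measurableSet_Ioi
    (fun s (hs : 0 < s) => by
      refine (((hasDerivAt_const s x).div (hasDerivAt_id s) hs.ne').congr_deriv
        ?_).hasDerivWithinAt
      simp [neg_div])
    (fun s (hs : 0 < s) t (ht : 0 < t) hst => by
      have hst' : x / s = x / t := hst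
      field_simp at hst'
      exact hst'.symm) g
  rw [himage] at h
  rw [h]
  refine MeasureTheory.setIntegral_congr_fun measurableSet_Ioi fun s (hs : 0 < s) => ?_
  simp only [smul_eq_mul, abs_neg]
  rw [abs_of_pos (by positivity)]

theorem hasDerivAt_airyMoment (p : ℕ) {x : ℝ} (hx : 0 < x) :
    HasDerivAt (airyMoment p)
      (∫ t in Set.Ioi (0 : ℝ),
        -(x ^ 2 / t ^ 3) * (t ^ p * rexp (-(t ^ 3 / 3) - x ^ 3 / (3 * t ^ 3)))) x := by
  refine (hasDerivAt_integral_of_dominated_loc_of_deriv_le (𝕜 := ℝ)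
    (bound := fun t => 6 / x * (t ^ p * rexp (-(t ^ 3 / 3))))
    (F' := fun x t => -(x ^ 2 / t ^ 3) * (t ^ p * rexp (-(t ^ 3 / 3) - x ^ 3 / (3 * t ^ 3))))
    (s := Set.Ioi (x / 2)) (Ioi_mem_nhds (by linarith))
    (.of_forall fun y => (measurable_airyMoment_integrand p y).aestronglyMeasurable)
    (integrableOn_airyMoment_integrand p hx.le) ?_ ?_
    ((integrableOn_pow_mul_exp_neg_cube p).const_mul _) ?_).2
  · exact Measurable.aestronglyMeasurable (by fun_prop)
  · filter_upwards [MeasureTheory.ae_restrict_mem measurableSet_Ioi] with t (ht : 0 < t)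
      y (hy : x / 2 < y)
    have hy0 : 0 < y := by linarith
    rw [norm_mul, norm_neg, Real.norm_of_nonneg (by positivity),
      Real.norm_of_nonneg (by positivity)]
    have hexp : y ^ 3 / (3 * t ^ 3) * rexp (-(y ^ 3 / (3 * t ^ 3))) ≤ 1 :=
      (Real.mul_exp_neg_le_exp_neg_one _).trans (Real.exp_le_one_iff.2 (by norm_num))
    have hxy : 3 / y ≤ 6 / x := by
      rw [div_le_div_iff₀ hy0 hx]
      linarith
    calc y ^ 2 / t ^ 3 * (t ^ p * rexp (-(t ^ 3 / 3) - y ^ 3 / (3 * t ^ 3)))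
        = 3 / y * (y ^ 3 / (3 * t ^ 3) * rexp (-(y ^ 3 / (3 * t ^ 3))))
            * (t ^ p * rexp (-(t ^ 3 / 3))) := by
          rw [sub_eq_add_neg, Real.exp_add]
          field_simp
      _ ≤ 6 / x * 1 * (t ^ p * rexp (-(t ^ 3 / 3))) := by gcongr
      _ = _ := by ring
  · filter_upwards [MeasureTheory.ae_restrict_mem measurableSet_Ioi] with t (ht : 0 < t) y _
    have h : HasDerivAt (fun y : ℝ => -(t ^ 3 / 3) - y ^ 3 / (3 * t ^ 3)) (-(y ^ 2 / t ^ 3)) y := by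
      refine (((hasDerivAt_pow 3 y).div_const (3 * t ^ 3)).const_sub
        (-(t ^ 3 / 3))).congr_deriv ?_
      field_simp
      norm_num
    exact (h.exp.const_mul (t ^ p)).congr_deriv (by ring)

theorem hasDerivAt_airyMoment_zero {x : ℝ} (hx : 0 < x) :
    HasDerivAt (airyMoment 0) (-airyMoment 1 x) x := by
  convert hasDerivAt_airyMoment 0 hx using 1
  rw [integral_Ioi_comp_div hx, airyMoment, ← MeasureTheory.integral_neg]
  refine MeasureTheory.setIntegral_congr_fun measurableSet_Ioi fun s (hs : 0 < s) => ?_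
  have : -((x / s) ^ 3 / 3) - x ^ 3 / (3 * (x / s) ^ 3) = -(s ^ 3 / 3) - x ^ 3 / (3 * s ^ 3) := by
    field_simp
    ring
  simp only [this]
  field_simp

theorem hasDerivAt_airyMoment_one {x : ℝ} (hx : 0 < x) :
    HasDerivAt (airyMoment 1) (-(x * airyMoment 0 x)) x := by
  convert hasDerivAt_airyMoment 1 hx using 1
  rw [integral_Ioi_comp_div hx, airyMoment, ← MeasureTheory.integral_const_mul,
    ← MeasureTheory.integral_neg]
  refine MeasureTheory.setIntegral_congr_fun measurableSet_Ioi fun s (hs : 0 < s) => ?_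
  have : -((x / s) ^ 3 / 3) - x ^ 3 / (3 * (x / s) ^ 3) = -(s ^ 3 / 3) - x ^ 3 / (3 * s ^ 3) := by
    field_simp
    ring
  simp only [this]
  field_simp

theorem eq_of_hasDerivAt_zero_of_pos {f : ℝ → ℂ} (hf : ContinuousOn f (Set.Ici 0))
    (hf' : ∀ x, 0 < x → HasDerivAt f 0 x) {x : ℝ} (hx : 0 ≤ x) : f x = f 0 := by
  have h := intervalIntegral.integral_eq_sub_of_hasDerivAt_of_le hx
    (hf.mono fun y hy => hy.1) (fun y hy => hf' y hy.1) (by simp)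
  simp only [intervalIntegral.integral_zero] at h
  exact sub_eq_zero.1 h.symm

/-- A solution of `y'' = x y` on the half-line with the initial data of a multiple of
`airyMoment 0` is that multiple of `airyMoment 0`. -/
theorem eq_mul_airyMoment_zero {B B' : ℝ → ℂ} (hB : ∀ x, HasDerivAt B (B' x) x)
    (hB' : ∀ x, HasDerivAt B' (x * B x) x)
    (h0 : B 0 * airyMoment 1 0 + B' 0 * airyMoment 0 0 = 0) {x : ℝ} (hx : 0 ≤ x) :
    B x = B 0 / airyMoment 0 0 * airyMoment 0 x := by
  have hBc : Continuous B := continuous_iff_continuousAt.2 fun x => (hB x).continuousAt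
  have hBc' : Continuous B' := continuous_iff_continuousAt.2 fun x => (hB' x).continuousAt
  have hJ (p : ℕ) : ContinuousOn (fun x => (airyMoment p x : ℂ)) (Set.Ici 0) :=
    Complex.continuous_ofReal.comp_continuousOn (continuousOn_airyMoment p)
  have hne {x : ℝ} (hx : 0 ≤ x) : (airyMoment 0 x : ℂ) ≠ 0 :=
    Complex.ofReal_ne_zero.2 (airyMoment_pos 0 hx).ne'
  have hwronskian {x : ℝ} (hx : 0 ≤ x) : B x * airyMoment 1 x + B' x * airyMoment 0 x = 0 := by
    refine (eq_of_hasDerivAt_zero_of_pos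
      (f := fun x => B x * airyMoment 1 x + B' x * airyMoment 0 x)
      ((hBc.continuousOn.mul (hJ 1)).add (hBc'.continuousOn.mul (hJ 0)))
      (fun x hx => ?_) hx).trans h0
    refine (((hB x).mul (hasDerivAt_airyMoment_one hx).ofReal_comp).add
      ((hB' x).mul (hasDerivAt_airyMoment_zero hx).ofReal_comp)).congr_deriv ?_
    push_cast
    ring
  have hquot := eq_of_hasDerivAt_zero_of_pos (f := fun x => B x / airyMoment 0 x)
    (hBc.continuousOn.div (hJ 0) fun x hx => hne hx) (fun x hx' => by
      refine ((hB x).div (hasDerivAt_airyMoment_zero hx').ofReal_comp (hne hx'.le)).congr_deriv ?_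
      rw [div_eq_zero_iff]
      left
      rw [← hwronskian hx'.le]
      push_cast
      ring) hx
  rw [← hquot, div_mul_cancel₀ _ (hne hx)]

theorem airy_initial_data_mul_airyMoment :
    (3 : ℝ) ^ (-(2 : ℝ) / 3) / Real.Gamma (2 / 3) * airyMoment 1 0 =
      3 ^ (-(1 : ℝ) / 3) / Real.Gamma (1 / 3) * airyMoment 0 0 := by
  have h1 : 0 < Real.Gamma (1 / 3) := Real.Gamma_pos_of_pos (by norm_num)
  have h2 : 0 < Real.Gamma (2 / 3) := Real.Gamma_pos_of_pos (by norm_num)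
  have key (r : ℝ) : (3 : ℝ) ^ r * (1 / 3) ^ r = 1 := by
    rw [← Real.mul_rpow (by norm_num) (by norm_num)]
    norm_num
  rw [airyMoment_zero, airyMoment_zero]
  norm_num
  norm_num at h1 h2 key
  field_simp
  rw [key, key]

theorem hasDerivAt_mul_comp_mul {f : ℂ → ℂ} (hf : Differentiable ℂ f) (a c : ℂ) (w : ℝ) :
    HasDerivAt (fun w : ℝ => a * f (c * w)) (a * c * deriv f (c * w)) w := by
  have h : HasDerivAt (fun z : ℂ => a * f (c * z)) (a * c * deriv f (c * w)) (w : ℂ) := by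
    refine (((hf (c * w)).hasDerivAt.comp (w : ℂ)
      ((hasDerivAt_id (w : ℂ)).const_mul c)).const_mul a).congr_deriv ?_
    ring
  exact h.comp_ofReal

theorem exp_pi_div_three_mul_I :
    Complex.exp ((Real.pi / 3 : ℂ) * Complex.I) = 1 / 2 + (√3 / 2 : ℝ) * Complex.I := by
  have h : (Real.pi / 3 : ℂ) = ((Real.pi / 3 : ℝ) : ℂ) := by push_cast; rfl
  rw [Complex.exp_mul_I, h, ← Complex.ofReal_cos, ← Complex.ofReal_sin, Real.cos_pi_div_three,
    Real.sin_pi_div_three]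
  push_cast
  rfl

theorem exp_neg_pi_div_three_mul_I :
    Complex.exp (-(Real.pi / 3 : ℂ) * Complex.I) = 1 / 2 - (√3 / 2 : ℝ) * Complex.I := by
  have h : (Real.pi / 3 : ℂ) = ((Real.pi / 3 : ℝ) : ℂ) := by push_cast; rfl
  rw [Complex.exp_mul_I, h, Complex.cos_neg, Complex.sin_neg, ← Complex.ofReal_cos,
    ← Complex.ofReal_sin, Real.cos_pi_div_three, Real.sin_pi_div_three]
  push_cast
  ring

theorem add_eq_one_of_exp_pi_div_three :
    Complex.exp (-(Real.pi / 3 : ℂ) * Complex.I) + Complex.exp ((Real.pi / 3 : ℂ) * Complex.I)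
      = 1 := by
  rw [exp_pi_div_three_mul_I, exp_neg_pi_div_three_mul_I]
  ring

theorem mul_eq_one_of_exp_pi_div_three :
    Complex.exp (-(Real.pi / 3 : ℂ) * Complex.I) * Complex.exp ((Real.pi / 3 : ℂ) * Complex.I)
      = 1 := by
  rw [← Complex.exp_add]
  simp

theorem sub_eq_of_exp_pi_div_three :
    Complex.exp ((Real.pi / 3 : ℂ) * Complex.I) - Complex.exp (-(Real.pi / 3 : ℂ) * Complex.I)
      = (√3 : ℝ) * Complex.I := by
  rw [exp_pi_div_three_mul_I, exp_neg_pi_div_three_mul_I]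
  push_cast
  ring

theorem pow_three_eq_neg_one_of_add_of_mul {p m : ℂ} (hadd : p + m = 1) (hmul : p * m = 1) :
    p ^ 3 = -1 := by
  obtain rfl : m = 1 - p := by rw [← hadd]; ring
  linear_combination -(p + 1) * hmul

/-- The sum of the two rotated Airy functions at `-x` is a positive multiple of `airyMoment 0`. -/
theorem rotated_airy_add_eq {Ai : ℂ → ℂ} (hAi : Differentiable ℂ Ai)
    (hAi' : Differentiable ℂ (deriv Ai)) (hode : ∀ z : ℂ, deriv (deriv Ai) z = z * Ai z)
    (h0 : Ai 0 * airyMoment 1 0 + deriv Ai 0 * airyMoment 0 0 = 0)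
    {p m : ℂ} (hadd : p + m = 1) (hmul : p * m = 1) {x : ℝ} (hx : 0 ≤ x) :
    p * Ai (p * (-x : ℝ)) + m * Ai (m * (-x : ℝ)) =
      Ai 0 / airyMoment 0 0 * airyMoment 0 x := by
  have hp := pow_three_eq_neg_one_of_add_of_mul hadd hmul
  have hm := pow_three_eq_neg_one_of_add_of_mul ((add_comm m p).trans hadd)
    ((mul_comm m p).trans hmul)
  have hsq : p ^ 2 + m ^ 2 = -1 := by linear_combination (p + m + 1) * hadd - 2 * hmul
  have h := eq_mul_airyMoment_zero
    (B := fun x : ℝ => p * Ai (-p * x) + m * Ai (-m * x))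
    (B' := fun x : ℝ => p * -p * deriv Ai (-p * x) + m * -m * deriv Ai (-m * x))
    (fun x => (hasDerivAt_mul_comp_mul hAi p (-p) x).add (hasDerivAt_mul_comp_mul hAi m (-m) x))
    (fun x => by
      refine ((hasDerivAt_mul_comp_mul hAi' (p * -p) (-p) x).add
        (hasDerivAt_mul_comp_mul hAi' (m * -m) (-m) x)).congr_deriv ?_
      rw [hode, hode]
      linear_combination -(p * x * Ai (-p * x)) * hp - (m * x * Ai (-m * x)) * hm)
    (by
      simp only [Complex.ofReal_zero, mul_zero]
      linear_combination h0 + Ai 0 * airyMoment 1 0 * hadd - deriv Ai 0 * airyMoment 0 0 * hsq) hx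
  have hB0 : p * Ai 0 + m * Ai 0 = Ai 0 := by rw [← add_mul, hadd, one_mul]
  simpa [hB0] using h

theorem rotated_airy_wronskian {Ai : ℂ → ℂ} (hAi : Differentiable ℂ Ai)
    (hAi' : Differentiable ℂ (deriv Ai)) (hode : ∀ z : ℂ, deriv (deriv Ai) z = z * Ai z)
    {p m : ℂ} (hadd : p + m = 1) (hmul : p * m = 1) (w : ℝ) :
    p * Ai (p * w) * (m * m * deriv Ai (m * w)) - p * p * deriv Ai (p * w) * (m * Ai (m * w)) =
      (m - p) * (Ai 0 * deriv Ai 0) := by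
  have hp := pow_three_eq_neg_one_of_add_of_mul hadd hmul
  have hm := pow_three_eq_neg_one_of_add_of_mul ((add_comm m p).trans hadd)
    ((mul_comm m p).trans hmul)
  have hW (w : ℝ) := ((hasDerivAt_mul_comp_mul hAi p p w).mul
    (hasDerivAt_mul_comp_mul hAi' (m * m) m w)).sub
    ((hasDerivAt_mul_comp_mul hAi' (p * p) p w).mul (hasDerivAt_mul_comp_mul hAi m m w))
  have h := is_const_of_deriv_eq_zero (fun w => (hW w).differentiableAt) (fun w => by
    rw [(hW w).deriv, hode, hode]
    linear_combination (m * w * Ai (m * w) * (p * Ai (p * w))) * hm -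
      (p * w * Ai (p * w) * (m * Ai (m * w))) * hp) w 0
  simp only [Pi.sub_apply, Pi.mul_apply, Complex.ofReal_zero, mul_zero] at h
  rw [h]
  linear_combination (Ai 0 * deriv Ai 0 * (m - p)) * hmul

/-- A continuous phase of a nonvanishing real-analytic function is real-analytic. -/
theorem analyticAt_of_exp_neg_mul_I_eq {L : ℝ → ℝ} {g : ℂ → ℂ} {w₀ : ℝ}
    (hL : ContinuousAt L w₀) (hg : AnalyticAt ℂ g w₀)
    (h : ∀ w : ℝ, Complex.exp (-(L w : ℂ) * Complex.I) = g w) : AnalyticAt ℝ L w₀ := by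
  have hg0 : g w₀ ≠ 0 := by
    rw [← h]
    exact Complex.exp_ne_zero _
  have hlog : AnalyticAt ℂ (fun z => Complex.log (g z / g w₀)) w₀ := by
    refine (hg.div analyticAt_const hg0).clog ?_
    simp [div_self hg0]
  have hlog' : AnalyticAt ℝ (fun w : ℝ => Complex.log (g w / g w₀)) w₀ :=
    hlog.restrictScalars.comp (Complex.ofRealCLM.analyticAt w₀)
  have hL' : AnalyticAt ℝ (fun w : ℝ => L w₀ - (Complex.log (g w / g w₀)).im) w₀ :=
    analyticAt_const.sub ((Complex.imCLM.analyticAt _).comp hlog')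
  refine hL'.congr ?_
  have hnear : ∀ᶠ w in nhds w₀, |L w - L w₀| < Real.pi :=
    Metric.continuousAt_iff'.1 hL Real.pi Real.pi_pos
  filter_upwards [hnear] with w hw
  rw [abs_lt] at hw
  have hexp : g w / g w₀ = Complex.exp (((L w₀ - L w : ℝ) : ℂ) * Complex.I) := by
    rw [← h, ← h, ← Complex.exp_sub]
    congr 1
    push_cast
    ring
  rw [hexp, Complex.log_exp (by simp; linarith) (by simp; linarith)]
  simp

/-- If `L` decreases to the left from a value in `(0, π)`, avoids the zeros of `1 - cos` and
satisfies a differential inequality `c (1 - cos L) ≤ L'`, then it tends to `0` at `-∞`. -/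
theorem tendsto_atBot_zero_of_le_deriv {L : ℝ → ℝ} (hd : Differentiable ℝ L) (hmono : StrictMono L)
    (h0 : 0 < L 0) (hpi : L 0 < Real.pi) {c : ℝ} (hc : 0 < c)
    (hne : ∀ w ≤ 0, Real.cos (L w) ≠ 1)
    (hle : ∀ w ≤ 0, c * (1 - Real.cos (L w)) ≤ deriv L w) :
    Tendsto L atBot (nhds 0) := by
  have hpos : ∀ w ≤ 0, 0 < L w := by
    intro w hw
    by_contra! hLw
    obtain ⟨v, hv, hv0⟩ := intermediate_value_Icc hw hd.continuous.continuousOn ⟨hLw, h0.le⟩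
    exact hne v hv.2 (by rw [hv0, Real.cos_zero])
  have hsmall : ∀ ε > 0, ∃ w ≤ 0, L w < ε := by
    intro ε hε
    by_contra! hge
    have hε0 : ε ≤ L 0 := hge 0 le_rfl
    have hcos : 0 < 1 - Real.cos ε := by
      have := Real.cos_lt_cos_of_nonneg_of_le_pi le_rfl (by linarith) hε
      rw [Real.cos_zero] at this
      linarith
    set δ := c * (1 - Real.cos ε)
    have hδ0 : 0 < δ := mul_pos hc hcos
    have hderiv : ∀ w ≤ 0, δ ≤ deriv L w := by
      intro w hw
      refine le_trans ?_ (hle w hw)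
      have := Real.cos_le_cos_of_nonneg_of_le_pi hε.le
        ((hmono.monotone hw).trans hpi.le) (hge w hw)
      exact mul_le_mul_of_nonneg_left (by linarith) hc.le
    have hw : -(L 0 / δ) ≤ 0 := by
      have := div_pos h0 hδ0
      linarith
    have h := (convex_Iic (0 : ℝ)).mul_sub_le_image_sub_of_le_deriv hd.continuous.continuousOn
      hd.differentiableOn (fun x hx => hderiv x (interior_subset hx : x ∈ Set.Iic 0))
      _ hw 0 Set.self_mem_Iic hw
    have hmul : δ * (0 - -(L 0 / δ)) = L 0 := by
      field_simp
      ring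
    linarith [hpos _ hw]
  rw [Metric.tendsto_nhds]
  intro ε hε
  obtain ⟨v, hv, hvε⟩ := hsmall ε hε
  filter_upwards [eventually_le_atBot v] with w hw
  rw [Real.dist_eq, sub_zero, abs_of_pos (hpos w (hw.trans hv))]
  exact (hmono.monotone hw).trans_lt hvε

/-- the function `L`, defined by `e^{-iL(ω)} = -A₋(ω)/A₊(ω)` and `L(0) = π/3`,
is real-analytic on `ℝ`, strictly increasing with everywhere positive derivative,
satisfies `L(0) = π/3`, and tends to `0` at `-∞`. -/
theorem L_analytic_strictMono
    (Ai : ℂ → ℂ)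
    (hAi_diff : Differentiable ℂ Ai)
    (hAi_diff' : Differentiable ℂ (deriv Ai))
    (hAi_ode : ∀ z : ℂ, deriv (deriv Ai) z = z * Ai z)
    (hAi_zero : Ai 0 = (3 : ℂ) ^ (-(2 : ℂ)/3) / Complex.Gamma (2/3))
    (hAi_zero' : deriv Ai 0 = -((3 : ℂ) ^ (-(1 : ℂ)/3)) / Complex.Gamma (1/3))
    (hAi_real : ∀ x : ℝ, (Ai x).im = 0)
    (L : ℝ → ℝ)
    (hL_cont : Continuous L)
    (hL_zero : L 0 = Real.pi / 3)
    (hAp_ne : ∀ w : ℝ, Aplus Ai w ≠ 0)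
    (hL_char : ∀ w : ℝ, Complex.exp (-(L w : ℂ) * Complex.I) = -(Aminus Ai w) / (Aplus Ai w)) :
    AnalyticOnNhd ℝ L Set.univ ∧
    StrictMono L ∧ (∀ w : ℝ, 0 < deriv L w) ∧
    L 0 = Real.pi / 3 ∧
    Tendsto L atBot (nhds 0) := by
  set p := Complex.exp (-(Real.pi / 3 : ℂ) * Complex.I)
  set m := Complex.exp ((Real.pi / 3 : ℂ) * Complex.I)
  have hadd : p + m = 1 := add_eq_one_of_exp_pi_div_three
  have hmul : p * m = 1 := mul_eq_one_of_exp_pi_div_three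
  have hsub : m - p = (√3 : ℝ) * Complex.I := sub_eq_of_exp_pi_div_three
  have hAp (z : ℂ) : Aplus Ai z = p * Ai (p * z) := rfl
  have hAm (z : ℂ) : Aminus Ai z = m * Ai (m * z) := rfl
  obtain ⟨a, ha_def⟩ : ∃ a : ℝ, a = (3 : ℝ) ^ (-(2 : ℝ) / 3) / Real.Gamma (2 / 3) := ⟨_, rfl⟩
  obtain ⟨b, hb_def⟩ : ∃ b : ℝ, b = (3 : ℝ) ^ (-(1 : ℝ) / 3) / Real.Gamma (1 / 3) := ⟨_, rfl⟩
  have ha : 0 < a := ha_def ▸ div_pos (by positivity) (Real.Gamma_pos_of_pos (by norm_num))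
  have hb : 0 < b := hb_def ▸ div_pos (by positivity) (Real.Gamma_pos_of_pos (by norm_num))
  have hAi0 : Ai 0 = a := by
    rw [hAi_zero, ha_def, Complex.ofReal_div, Complex.ofReal_cpow (by norm_num),
      ← Complex.Gamma_ofReal]
    push_cast
    rfl
  have hAi0' : deriv Ai 0 = -b := by
    rw [hAi_zero', hb_def, Complex.ofReal_div, Complex.ofReal_cpow (by norm_num),
      ← Complex.Gamma_ofReal, neg_div]
    push_cast
    rfl
  have hdata : a * airyMoment 1 0 = b * airyMoment 0 0 := by
    rw [ha_def, hb_def]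
    exact airy_initial_data_mul_airyMoment
  -- analyticity
  have hanalytic : ∀ w, AnalyticAt ℝ L w := fun w =>
    analyticAt_of_exp_neg_mul_I_eq (g := fun z => -(Aminus Ai z) / Aplus Ai z)
      hL_cont.continuousAt
      (AnalyticAt.div
        (Differentiable.analyticAt (by unfold Aminus; fun_prop) _)
        (Differentiable.analyticAt (by unfold Aplus; fun_prop) _) (hAp_ne w)) hL_char
  have hd : Differentiable ℝ L := fun w => (hanalytic w).differentiableAt
  -- the derivative of the phase in terms of the Wronskian
  have hAm_eq (w : ℝ) :
      Complex.exp (-(L w : ℂ) * Complex.I) * (p * Ai (p * w)) = -(m * Ai (m * w)) := by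
    have := hAp_ne w
    rw [hL_char w, ← hAp, ← hAm, div_mul_cancel₀ _ this]
  have hκ : 0 < √3 * (a * b) := by positivity
  have hderiv (w : ℝ) :
      ((deriv L w : ℝ) : ℂ) * (p * Ai (p * w) * (m * Ai (m * w))) = (√3 * (a * b) : ℝ) := by
    have h1 := (((hd w).hasDerivAt.ofReal_comp.neg.mul_const Complex.I).cexp.mul
      (hasDerivAt_mul_comp_mul hAi_diff p p w))
    have h2 := (hasDerivAt_mul_comp_mul hAi_diff m m w).neg
    have h3 := h1.unique (h2.congr_of_eventuallyEq (.of_forall hAm_eq))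
    have hW := rotated_airy_wronskian hAi_diff hAi_diff' hAi_ode hadd hmul w
    rw [hsub, hAi0, hAi0'] at hW
    have h4 := hAm_eq w
    simp only [Pi.neg_apply] at h3
    push_cast
    linear_combination (-Complex.I * (p * Ai (p * w))) * h3 + Complex.I * hW +
      (((deriv L w : ℝ) : ℂ) * (p * Ai (p * w)) +
        Complex.I * (p * p * deriv Ai (p * w))) * h4 -
      (Complex.exp (-(L w : ℂ) * Complex.I) * ((deriv L w : ℝ) : ℂ) * (p * Ai (p * w)) ^ 2 +
        (√3 : ℝ) * (a * b)) * Complex.I_sq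
  have hderiv_ne (w : ℝ) : deriv L w ≠ 0 := by
    intro h
    have := hderiv w
    rw [h, Complex.ofReal_zero, zero_mul, eq_comm, Complex.ofReal_eq_zero] at this
    exact hκ.ne' this
  have hderiv_zero : 0 < deriv L 0 := by
    have h := hderiv 0
    simp only [Complex.ofReal_zero, mul_zero, hAi0] at h
    have h' : ((deriv L 0 : ℝ) : ℂ) * (a * a) = (√3 * (a * b) : ℝ) := by
      linear_combination h - ((deriv L 0 : ℝ) : ℂ) * (a * a) * hmul
    have h'' : deriv L 0 * (a * a) = √3 * (a * b) := by exact_mod_cast h'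
    exact pos_of_mul_pos_left (h'' ▸ hκ) (by positivity)
  have hderiv_pos (w : ℝ) : 0 < deriv L w := by
    rcases hasDerivWithinAt_forall_lt_or_forall_gt_of_forall_ne convex_univ
      (fun w _ => (hd w).hasDerivAt.hasDerivWithinAt) (m := 0) (fun w _ => hderiv_ne w) with h | h
    · exact absurd (h 0 trivial) hderiv_zero.not_gt
    · exact h w trivial
  have hmono := strictMono_of_deriv_pos hderiv_pos
  refine ⟨fun w _ => hanalytic w, hmono, hderiv_pos, hL_zero, ?_⟩
  -- comparison of `L'` with `1 - cos L` on the negative half-line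
  have hJ0 := airyMoment_pos 0 le_rfl
  have hB (w : ℝ) (hw : w ≤ 0) :
      p * Ai (p * w) + m * Ai (m * w) = (a / airyMoment 0 0 * airyMoment 0 (-w) : ℝ) := by
    have h := rotated_airy_add_eq hAi_diff hAi_diff' hAi_ode (by
      rw [hAi0, hAi0']
      exact_mod_cast show a * airyMoment 1 0 + -b * airyMoment 0 0 = 0 by rw [hdata]; ring)
      hadd hmul (neg_nonneg.2 hw)
    rw [neg_neg, hAi0] at h
    rw [h]
    push_cast
    rfl
  have hcos (w : ℝ) (hw : w ≤ 0) :
      (a / airyMoment 0 0 * airyMoment 0 (-w)) ^ 2 * deriv L w =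
        2 * (√3 * (a * b)) * (1 - Real.cos (L w)) := by
    have h1 : 2 * Complex.cos (L w) =
        Complex.exp (L w * Complex.I) + Complex.exp (-(L w : ℂ) * Complex.I) := by
      rw [Complex.cos]
      ring
    have h2 : Complex.exp (L w * Complex.I) * Complex.exp (-(L w : ℂ) * Complex.I) = 1 := by
      rw [← Complex.exp_add]
      simp
    have h3 := hAm_eq w
    have h4 := hderiv w
    have h5 : ((a / airyMoment 0 0 * airyMoment 0 (-w) : ℝ) : ℂ) ^ 2 * deriv L w =
        2 * (√3 * (a * b) : ℝ) * (1 - Complex.cos (L w)) := by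
      rw [← hB w hw]
      linear_combination (2 - 2 * Complex.cos (L w)) * h4 +
        ((deriv L w : ℝ) : ℂ) * (p * Ai (p * w)) * (m * Ai (m * w)) * h1 +
        ((deriv L w : ℝ) : ℂ) * (m * Ai (m * w)) * h3 +
        ((deriv L w : ℝ) : ℂ) * (p * Ai (p * w)) *
          (Complex.exp (L w * Complex.I) * h3 - p * Ai (p * w) * h2)
    exact_mod_cast h5
  refine tendsto_atBot_zero_of_le_deriv hd hmono (by rw [hL_zero]; positivity)
    (by rw [hL_zero]; linarith [Real.pi_pos]) (c := 2 * (√3 * (a * b)) / a ^ 2) (by positivity)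
    (fun w hw hw1 => ?_) (fun w hw => ?_)
  · have h := hcos w hw
    have hJ := airyMoment_pos 0 (neg_nonneg.2 hw)
    have := mul_pos (pow_pos (mul_pos (div_pos ha hJ0) hJ) 2) (hderiv_pos w)
    rw [h, hw1] at this
    simp at this
  · have hJ := airyMoment_pos 0 (neg_nonneg.2 hw)
    rw [div_mul_eq_mul_div, div_le_iff₀ (by positivity), ← hcos w hw, mul_comm (deriv L w)]
    have hle : a / airyMoment 0 0 * airyMoment 0 (-w) ≤ a := by
      rw [div_mul_eq_mul_div, div_le_iff₀ hJ0]
      gcongr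
      exact airyMoment_le_airyMoment_zero 0 (neg_nonneg.2 hw)
    have := (hderiv_pos w).le
    gcongr
end

section
/- There exists a sequence of real numbers (b_k)_{k≥1} with b₁ > 0 such that B admits the asymptotic expansion B(u) ~ Σ_{k≥1} b_k u^{−k} as u → +∞; that is, for every n ≥ 1 there is a constant C_n with |B(u) − Σ_{k=1}^{n} b_k u^{−k}| ≤ C_n u^{−(n+1)} for all u ≥ 1. Equivalently, for ω ≥ 1 one has L(ω) = (4/3)ω^{3/2} + π/2 − B(ω^{3/2}) with B as above. -/
open Real Complex Filter

/-- `B(u) = (4/3)u + π/2 − L(u^{2/3})`. -/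
noncomputable def Bfun (L : ℝ → ℝ) (u : ℝ) : ℝ :=
  (4/3) * u + Real.pi / 2 - L (u ^ ((2 : ℝ)/3))

section AiryAsymptotics

open Set MeasureTheory Topology

/-! ### The cubic Laplace integrals and the bounded solution of the Airy equation -/

/-- The integral `∫₀^∞ r^k exp(-r³/3 - s r) dr`. -/
noncomputable def cubicLaplace (k : ℕ) (s : ℂ) : ℂ :=
  ∫ r in Ioi (0 : ℝ), (r : ℂ) ^ k * Complex.exp (-(r : ℂ) ^ 3 / 3 - s * r)

lemma norm_cubicLaplace_integrand (k : ℕ) (s : ℂ) {r : ℝ} (hr : 0 < r) :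
    ‖(r : ℂ) ^ k * Complex.exp (-(r : ℂ) ^ 3 / 3 - s * r)‖ =
      r ^ k * Real.exp (-r ^ 3 / 3 - s.re * r) := by
  rw [norm_mul, norm_pow, Complex.norm_real, Real.norm_of_nonneg hr.le, Complex.norm_exp]
  congr 2
  have : (-(r : ℂ) ^ 3 / 3 - s * r) = ((-r ^ 3 / 3 : ℝ) : ℂ) - s * r := by push_cast; ring
  rw [this, Complex.sub_re, Complex.ofReal_re]
  simp

lemma integrableOn_pow_mul_exp_cubic (k : ℕ) (c : ℝ) :
    IntegrableOn (fun r : ℝ => r ^ k * Real.exp (-r ^ 3 / 3 - c * r)) (Ioi 0) := by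
  set m : ℝ := |c| + 1
  have hm : 1 ≤ m := by simp [m]
  have hint : IntegrableOn (fun r : ℝ => Real.exp (2 / 3 * m ^ 3) * (Real.exp (-r) * r ^ k))
      (Ioi 0) := by
    have h := Real.GammaIntegral_convergent (s := k + 1) (by positivity)
    simp only [add_sub_cancel_right, Real.rpow_natCast] at h
    exact h.const_mul _
  refine Integrable.mono' hint (by fun_prop) ?_
  filter_upwards [ae_restrict_mem measurableSet_Ioi] with r (hr : 0 < r)
  rw [Real.norm_of_nonneg (by positivity),
    show Real.exp (2 / 3 * m ^ 3) * (Real.exp (-r) * r ^ k) =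
      r ^ k * Real.exp (2 / 3 * m ^ 3 - r) by rw [sub_eq_add_neg, Real.exp_add]; ring]
  refine mul_le_mul_of_nonneg_left (Real.exp_le_exp.2 ?_) (by positivity)
  have h1 : -c * r ≤ |c| * r := by gcongr; exact neg_le_abs c
  have h2 : 0 ≤ (r - m) ^ 2 * (r + 2 * m) := by positivity
  have h3 : m * r ≤ m ^ 2 * r := by nlinarith [mul_nonneg (sub_nonneg.2 hm) (by positivity : 0 ≤ m * r)]
  have h4 : m * r = |c| * r + r := by simp only [m]; ring
  nlinarith

lemma integrableOn_cubicLaplace (k : ℕ) (s : ℂ) :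
    IntegrableOn (fun r : ℝ => (r : ℂ) ^ k * Complex.exp (-(r : ℂ) ^ 3 / 3 - s * r)) (Ioi 0) := by
  refine Integrable.mono' (integrableOn_pow_mul_exp_cubic k s.re) (by fun_prop) ?_
  filter_upwards [ae_restrict_mem measurableSet_Ioi] with r hr
  exact (norm_cubicLaplace_integrand k s hr).le

lemma hasDerivAt_cubicLaplace (k : ℕ) (s : ℂ) :
    HasDerivAt (cubicLaplace k) (-cubicLaplace (k + 1) s) s := by
  have key := (hasDerivAt_integral_of_dominated_loc_of_deriv_le
    (μ := volume.restrict (Ioi (0 : ℝ)))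
    (F := fun (s : ℂ) (r : ℝ) => (r : ℂ) ^ k * Complex.exp (-(r : ℂ) ^ 3 / 3 - s * r))
    (F' := fun (s : ℂ) (r : ℝ) => -((r : ℂ) ^ (k + 1) * Complex.exp (-(r : ℂ) ^ 3 / 3 - s * r)))
    (bound := fun r => r ^ (k + 1) * Real.exp (-r ^ 3 / 3 - (s.re - 1) * r))
    (Metric.ball_mem_nhds s one_pos) (Eventually.of_forall fun _ => by fun_prop)
    (integrableOn_cubicLaplace k s) (by fun_prop) ?_
    (integrableOn_pow_mul_exp_cubic (k + 1) (s.re - 1)) ?_).2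
  · simpa only [integral_neg] using! key
  · filter_upwards [ae_restrict_mem measurableSet_Ioi] with r (hr : 0 < r) x hx
    rw [norm_neg, norm_cubicLaplace_integrand _ _ hr]
    gcongr
    have h := (Complex.abs_re_le_norm (x - s)).trans_lt (mem_ball_iff_norm.1 hx)
    rw [Complex.sub_re, abs_lt] at h
    linarith
  · refine Eventually.of_forall fun r x _ => ?_
    have h := ((((hasDerivAt_id x).mul_const (r : ℂ)).const_sub
      (-(r : ℂ) ^ 3 / 3)).cexp).const_mul ((r : ℂ) ^ k)
    refine h.congr_deriv ?_
    simp only [id]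
    ring

lemma cubicLaplace_two_add (s : ℂ) : cubicLaplace 2 s + s * cubicLaplace 0 s = 1 := by
  have hd : ∀ r ∈ Ici (0 : ℝ), HasDerivAt
      (fun r : ℝ => -Complex.exp (-(r : ℂ) ^ 3 / 3 - s * r))
      ((r : ℂ) ^ 2 * Complex.exp (-(r : ℂ) ^ 3 / 3 - s * r) +
        s * ((r : ℂ) ^ 0 * Complex.exp (-(r : ℂ) ^ 3 / 3 - s * r))) r := by
    intro r _
    have h1 : HasDerivAt (fun z : ℂ => -Complex.exp (-z ^ 3 / 3 - s * z))
        (-(Complex.exp (-(r : ℂ) ^ 3 / 3 - s * r) * (-(3 * (r : ℂ) ^ 2) / 3 - s * 1))) r := by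
      have := ((((hasDerivAt_pow 3 (r : ℂ)).neg.div_const 3).sub
        ((hasDerivAt_id (r : ℂ)).const_mul s)).cexp).neg
      simpa using! this
    refine h1.comp_ofReal.congr_deriv ?_
    ring
  have hint := (integrableOn_cubicLaplace 2 s).add ((integrableOn_cubicLaplace 0 s).const_mul s)
  have hlim : Tendsto (fun r : ℝ => -Complex.exp (-(r : ℂ) ^ 3 / 3 - s * r)) atTop (𝓝 0) := by
    rw [tendsto_zero_iff_norm_tendsto_zero]
    have h : Tendsto (fun r : ℝ => Real.exp (-(r * (r ^ 2 / 3 + s.re)))) atTop (𝓝 0) := by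
      refine Real.tendsto_exp_neg_atTop_nhds_zero.comp ?_
      refine tendsto_id.atTop_mul_atTop₀ ?_
      exact tendsto_atTop_add_const_right _ _
        ((tendsto_pow_atTop two_ne_zero).atTop_div_const (by norm_num))
    refine h.congr' ?_
    filter_upwards [eventually_gt_atTop 0] with r hr
    have := norm_cubicLaplace_integrand 0 s hr
    simp only [pow_zero, one_mul] at this
    rw [norm_neg, this]
    congr 1
    ring
  have h := integral_Ioi_of_hasDerivAt_of_tendsto' hd hint hlim
  rw [integral_add (integrableOn_cubicLaplace 2 s) ((integrableOn_cubicLaplace 0 s).const_mul s),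
    integral_const_mul] at h
  simpa [cubicLaplace] using h

lemma norm_cubicLaplace_le (k : ℕ) {s : ℂ} (hs : 0 ≤ s.re) :
    ‖cubicLaplace k s‖ ≤ ∫ r in Ioi (0 : ℝ), r ^ k * Real.exp (-r ^ 3 / 3 - 0 * r) := by
  refine norm_integral_le_of_norm_le (integrableOn_pow_mul_exp_cubic k 0) ?_
  filter_upwards [ae_restrict_mem measurableSet_Ioi] with r (hr : 0 < r)
  rw [norm_cubicLaplace_integrand k s hr]
  gcongr

lemma cubicLaplace_zero_right (k : ℕ) :
    cubicLaplace k 0 =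
      (((3 : ℝ) ^ (((k : ℝ) + 1) / 3) * (1 / 3) * Real.Gamma (((k : ℝ) + 1) / 3) : ℝ) : ℂ) := by
  have h := _root_.integral_rpow_mul_exp_neg_mul_rpow (p := 3) (q := k) (b := 1 / 3) (by norm_num)
    (by linarith [k.cast_nonneg (α := ℝ)]) (by norm_num)
  have h3 : (1 / 3 : ℝ) ^ (-((k : ℝ) + 1) / 3) = 3 ^ (((k : ℝ) + 1) / 3) := by
    rw [one_div, Real.inv_rpow (by norm_num), ← Real.rpow_neg (by norm_num)]
    congr 1; ring
  rw [h3] at h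
  rw [← h, ← integral_complex_ofReal]
  refine setIntegral_congr_fun measurableSet_Ioi fun r _ => ?_
  have : (r : ℝ) ^ (3 : ℝ) = r ^ 3 := by exact_mod_cast Real.rpow_natCast r 3
  simp only [this, Real.rpow_natCast]
  push_cast
  congr 2
  ring

/-- A solution of the Airy equation, proportional to `Ai`, that is bounded with its derivative on
the positive half-line. -/
lemma exists_bounded_airy_solution : ∃ p p' : ℂ → ℂ,
    (∀ z, HasDerivAt p (p' z) z) ∧ (∀ z, HasDerivAt p' (z * p z) z) ∧
    p 0 ≠ 0 ∧
    p 0 * (-((3 : ℂ) ^ (-(1 : ℂ) / 3)) / Complex.Gamma (1 / 3)) =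
      p' 0 * ((3 : ℂ) ^ (-(2 : ℂ) / 3) / Complex.Gamma (2 / 3)) ∧
    ∃ M, ∀ x : ℝ, 0 ≤ x → ‖p x‖ ≤ M ∧ ‖p' x‖ ≤ M := by
  obtain ⟨a, b, ha, hb, hab, har, hbr, han, hbn⟩ : ∃ a b : ℂ, a ^ 2 = a - 1 ∧ b ^ 2 = b - 1 ∧
      a ≠ b ∧ 0 ≤ a.re ∧ 0 ≤ b.re ∧ a ^ 3 = -1 ∧ b ^ 3 = -1 := by
    have h3 : ((√3 : ℝ) : ℂ) ^ 2 = 3 := by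
      exact_mod_cast congrArg (fun x : ℝ => (x : ℂ)) (Real.sq_sqrt (by norm_num : (0 : ℝ) ≤ 3))
    have key : ∀ c : ℂ, c ^ 2 = c - 1 → c ^ 3 = -1 := fun c hc => by
      linear_combination (c + 1) * hc
    have h1 : (1 / 2 + (√3 : ℝ) / 2 * Complex.I) ^ 2 = (1 / 2 + (√3 : ℝ) / 2 * Complex.I) - 1 := by
      linear_combination Complex.I ^ 2 / 4 * h3 + 3 / 4 * Complex.I_sq
    have h2 : (1 / 2 - (√3 : ℝ) / 2 * Complex.I) ^ 2 = (1 / 2 - (√3 : ℝ) / 2 * Complex.I) - 1 := by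
      linear_combination Complex.I ^ 2 / 4 * h3 + 3 / 4 * Complex.I_sq
    refine ⟨_, _, h1, h2, ?_, ?_, ?_, key _ h1, key _ h2⟩
    · intro h
      have := congrArg Complex.im h
      simp at this
      have h0 : (0 : ℝ) < √3 := by positivity
      linarith
    · simp
    · simp
  have hlin : ∀ (c : ℂ) (k : ℕ) (z : ℂ), HasDerivAt (fun z => cubicLaplace k (c * z))
      (-c * cubicLaplace (k + 1) (c * z)) z := by
    intro c k z
    have h := (hasDerivAt_cubicLaplace k (c * z)).comp z ((hasDerivAt_id z).const_mul c)
    refine h.congr_deriv ?_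
    simp only [mul_one]
    ring
  refine ⟨fun z => a * cubicLaplace 0 (a * z) - b * cubicLaplace 0 (b * z),
    fun z => -a ^ 2 * cubicLaplace 1 (a * z) + b ^ 2 * cubicLaplace 1 (b * z),
    fun z => ?_, fun z => ?_, ?_, ?_, ?_⟩
  · refine (((hlin a 0 z).const_mul a).sub ((hlin b 0 z).const_mul b)).congr_deriv ?_
    ring
  · refine (((hlin a 1 z).const_mul (-a ^ 2)).add ((hlin b 1 z).const_mul (b ^ 2))).congr_deriv ?_
    have e1 := cubicLaplace_two_add (a * z)
    have e2 := cubicLaplace_two_add (b * z)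
    norm_num
    linear_combination cubicLaplace 2 (a * z) * han - cubicLaplace 2 (b * z) * hbn - e1 + e2
  · have hne : cubicLaplace 0 0 ≠ 0 := by
      rw [cubicLaplace_zero_right, Complex.ofReal_ne_zero]
      have := Real.Gamma_pos_of_pos (s := ((0 : ℕ) + 1 : ℝ) / 3) (by norm_num)
      positivity
    simp only [mul_zero, ← sub_mul]
    exact mul_ne_zero (sub_ne_zero.2 hab) hne
  · simp only [mul_zero, cubicLaplace_zero_right]
    have e1 : Complex.Gamma (1 / 3) = ((Real.Gamma (1 / 3) : ℝ) : ℂ) := by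
      rw [← Complex.Gamma_ofReal]; norm_num
    have e2 : Complex.Gamma (2 / 3) = ((Real.Gamma (2 / 3) : ℝ) : ℂ) := by
      rw [← Complex.Gamma_ofReal]; norm_num
    have e3 : (3 : ℂ) ^ (-(1 : ℂ) / 3) = (((3 : ℝ) ^ (-(1 : ℝ) / 3) : ℝ) : ℂ) := by
      rw [Complex.ofReal_cpow (by norm_num)]; norm_num
    have e4 : (3 : ℂ) ^ (-(2 : ℂ) / 3) = (((3 : ℝ) ^ (-(2 : ℝ) / 3) : ℝ) : ℂ) := by
      rw [Complex.ofReal_cpow (by norm_num)]; norm_num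
    have g1 := (Real.Gamma_pos_of_pos (s := 1 / 3) (by norm_num)).ne'
    have g2 := (Real.Gamma_pos_of_pos (s := 2 / 3) (by norm_num)).ne'
    have r1 : (3 : ℝ) ^ (1 / 3 : ℝ) * (3 : ℝ) ^ (-(1 : ℝ) / 3) = 1 := by
      rw [← Real.rpow_add (by norm_num)]; norm_num
    have r2 : (3 : ℝ) ^ (2 / 3 : ℝ) * (3 : ℝ) ^ (-(2 : ℝ) / 3) = 1 := by
      rw [← Real.rpow_add (by norm_num)]; norm_num
    have hc1 : ((((0 : ℕ) : ℝ) + 1) / 3) = 1 / 3 := by norm_num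
    have hc2 : ((((1 : ℕ) : ℝ) + 1) / 3) = 2 / 3 := by norm_num
    rw [e1, e2, e3, e4, hc1, hc2]
    have L1 : (3 : ℝ) ^ (1 / 3 : ℝ) * (1 / 3) * Real.Gamma (1 / 3) *
        ((3 : ℝ) ^ (-(1 : ℝ) / 3) / Real.Gamma (1 / 3)) = 1 / 3 := by
      field_simp; linarith
    have L2 : (3 : ℝ) ^ (2 / 3 : ℝ) * (1 / 3) * Real.Gamma (2 / 3) *
        ((3 : ℝ) ^ (-(2 : ℝ) / 3) / Real.Gamma (2 / 3)) = 1 / 3 := by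
      field_simp; linarith
    have L1' := congrArg (fun x : ℝ => (x : ℂ)) L1
    have L2' := congrArg (fun x : ℝ => (x : ℂ)) L2
    push_cast at L1' L2' ⊢
    rw [neg_div]
    generalize ((3 : ℝ) : ℂ) = t at *
    linear_combination (-(a - b)) * L1' + (a ^ 2 - b ^ 2) * L2' + (1 / 3) * ha - (1 / 3) * hb
  · set N : ℕ → ℝ := fun k => ∫ r in Ioi (0 : ℝ), r ^ k * Real.exp (-r ^ 3 / 3 - 0 * r)
    have hN : ∀ (c : ℂ), 0 ≤ c.re → ∀ (k : ℕ) (x : ℝ), 0 ≤ x → ‖cubicLaplace k (c * x)‖ ≤ N k :=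
      fun c hc k x hx => norm_cubicLaplace_le k (by simpa using mul_nonneg hc hx)
    have hN0 : ∀ k, 0 ≤ N k := fun k => (norm_nonneg _).trans (hN 0 le_rfl k 0 le_rfl)
    refine ⟨‖a‖ * N 0 + ‖b‖ * N 0 + (‖a‖ ^ 2 * N 1 + ‖b‖ ^ 2 * N 1), fun x hx => ⟨?_, ?_⟩⟩
    · refine (norm_sub_le _ _).trans ?_
      rw [norm_mul, norm_mul]
      have := hN a har 0 x hx
      have := hN b hbr 0 x hx
      have := hN0 1
      refine le_add_of_le_of_nonneg (by gcongr) (by positivity)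
    · refine (norm_add_le _ _).trans ?_
      rw [norm_mul, norm_mul, norm_neg, norm_pow, norm_pow]
      have := hN a har 1 x hx
      have := hN b hbr 1 x hx
      have := hN0 0
      refine le_add_of_nonneg_of_le (by positivity) (by gcongr)

/-! ### Confluent Laplace integrals -/

lemma norm_cpow_neg_le {a δ : ℝ} (ha : 0 ≤ a) (hδ : 0 < δ) {z : ℂ} (hz : δ ≤ ‖z‖) :
    ‖z ^ ((-a : ℝ) : ℂ)‖ ≤ δ ^ (-a) := by
  rw [Complex.norm_cpow_real]
  exact Real.rpow_le_rpow_of_nonpos hδ hz (by linarith)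

lemma add_ofReal_mem_slitPlane {w : ℂ} (hw : w ∈ slitPlane) {σ : ℝ} (hσ : 0 ≤ σ) :
    w + σ ∈ slitPlane := by
  rw [mem_slitPlane_iff] at hw ⊢
  simp only [add_re, ofReal_re, add_im, ofReal_im, add_zero]
  exact hw.imp (fun h => by linarith) id

lemma exists_ball_norm_add_ge {w₀ : ℂ} (hw : w₀ ∈ slitPlane) : ∃ δ > 0,
    ∀ w ∈ Metric.ball w₀ δ, w ∈ slitPlane ∧ ∀ σ : ℝ, 0 ≤ σ → δ ≤ ‖w + σ‖ := by
  obtain ⟨ε, hε, hball⟩ := Metric.isOpen_iff.1 isOpen_slitPlane w₀ hw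
  refine ⟨ε / 2, by positivity, fun w hw' => ⟨hball (Metric.ball_subset_ball (by linarith) hw'),
    fun σ hσ => ?_⟩⟩
  by_contra! hlt
  have hmem : -(σ : ℂ) ∈ Metric.ball w₀ ε := by
    rw [Metric.mem_ball, dist_eq_norm] at *
    have : -(σ : ℂ) - w₀ = (w - w₀) - (w + σ) := by ring
    rw [this]
    linarith [norm_sub_le (w - w₀) (w + σ)]
  have := hball hmem
  rw [mem_slitPlane_iff] at this
  simp at this
  linarith

/-- The integral `∫₀^∞ e^{-σ} σ^{-1/6} (w + σ)^{-a} dσ`. -/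
noncomputable def shiftedLaplace (a : ℝ) (w : ℂ) : ℂ :=
  ∫ σ in Ioi (0 : ℝ), ((Real.exp (-σ) * σ ^ ((5 / 6 : ℝ) - 1) : ℝ) : ℂ) *
    (w + σ) ^ ((-a : ℝ) : ℂ)

lemma continuousOn_expWeight (s : ℝ) :
    ContinuousOn (fun σ : ℝ => ((Real.exp (-σ) * σ ^ (s - 1) : ℝ) : ℂ)) (Ioi 0) :=
  Complex.continuous_ofReal.comp_continuousOn <| ContinuousOn.mul (by fun_prop)
    (continuousOn_id.rpow_const fun x hx => Or.inl (ne_of_gt hx))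

lemma norm_expWeight (s : ℝ) {σ : ℝ} (hσ : 0 < σ) :
    ‖((Real.exp (-σ) * σ ^ (s - 1) : ℝ) : ℂ)‖ = Real.exp (-σ) * σ ^ (s - 1) := by
  rw [Complex.norm_real, Real.norm_of_nonneg (by positivity)]

lemma aestronglyMeasurable_shiftedLaplace (a : ℝ) {w : ℂ} (hw : w ∈ slitPlane) :
    AEStronglyMeasurable (fun σ : ℝ => ((Real.exp (-σ) * σ ^ ((5 / 6 : ℝ) - 1) : ℝ) : ℂ) *
      (w + σ) ^ ((-a : ℝ) : ℂ)) (volume.restrict (Ioi 0)) := by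
  refine ContinuousOn.aestronglyMeasurable ?_ measurableSet_Ioi
  refine (continuousOn_expWeight _).mul (ContinuousOn.cpow_const (by fun_prop) ?_)
  exact fun σ hσ => add_ofReal_mem_slitPlane hw (le_of_lt hσ)

lemma integrableOn_shiftedLaplace {a : ℝ} (ha : 0 ≤ a) {w : ℂ} (hw : w ∈ slitPlane) :
    IntegrableOn (fun σ : ℝ => ((Real.exp (-σ) * σ ^ ((5 / 6 : ℝ) - 1) : ℝ) : ℂ) *
      (w + σ) ^ ((-a : ℝ) : ℂ)) (Ioi 0) := by
  obtain ⟨δ, hδ, hball⟩ := exists_ball_norm_add_ge hw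
  have hbound := (Real.GammaIntegral_convergent (s := 5 / 6) (by norm_num)).mul_const (δ ^ (-a))
  refine Integrable.mono' hbound (aestronglyMeasurable_shiftedLaplace a hw) ?_
  filter_upwards [ae_restrict_mem measurableSet_Ioi] with σ hσ
  rw [norm_mul, norm_expWeight _ hσ]
  have hσ' : 0 < σ := hσ
  gcongr
  exact norm_cpow_neg_le ha hδ ((hball w (Metric.mem_ball_self hδ)).2 σ hσ'.le)

lemma hasDerivAt_add_cpow (a : ℝ) {w : ℂ} (hw : w ∈ slitPlane) :
    HasDerivAt (fun z : ℂ => z ^ ((-a : ℝ) : ℂ)) (-(a : ℂ) * w ^ ((-(a + 1) : ℝ) : ℂ)) w := by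
  have h := (hasDerivAt_id w).cpow_const (c := ((-a : ℝ) : ℂ)) hw
  refine h.congr_deriv ?_
  simp only [id, mul_one]
  congr 2 <;> push_cast <;> ring

lemma hasDerivAt_shiftedLaplace {a : ℝ} (ha : 0 ≤ a) {w : ℂ} (hw : w ∈ slitPlane) :
    HasDerivAt (shiftedLaplace a) (-(a : ℂ) * shiftedLaplace (a + 1) w) w := by
  obtain ⟨δ, hδ, hball⟩ := exists_ball_norm_add_ge hw
  have hbound := ((Real.GammaIntegral_convergent (s := 5 / 6) (by norm_num)).mul_const
    (δ ^ (-(a + 1)))).const_mul a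
  have key := (hasDerivAt_integral_of_dominated_loc_of_deriv_le
    (μ := volume.restrict (Ioi (0 : ℝ)))
    (F := fun (w : ℂ) (σ : ℝ) => ((Real.exp (-σ) * σ ^ ((5 / 6 : ℝ) - 1) : ℝ) : ℂ) *
      (w + σ) ^ ((-a : ℝ) : ℂ))
    (F' := fun (w : ℂ) (σ : ℝ) => -(a : ℂ) * (((Real.exp (-σ) * σ ^ ((5 / 6 : ℝ) - 1) : ℝ) : ℂ) *
      (w + σ) ^ ((-(a + 1) : ℝ) : ℂ)))
    (Metric.ball_mem_nhds w hδ) ?_ (integrableOn_shiftedLaplace ha hw)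
    ((aestronglyMeasurable_shiftedLaplace (a + 1) hw).const_mul _) ?_ hbound ?_).2
  · rw [integral_const_mul] at key
    exact key
  · filter_upwards [isOpen_slitPlane.mem_nhds hw] with z hz
    exact aestronglyMeasurable_shiftedLaplace a hz
  · filter_upwards [ae_restrict_mem measurableSet_Ioi] with σ hσ z hz
    have hσ' : 0 < σ := hσ
    rw [norm_mul, norm_neg, Complex.norm_real, Real.norm_of_nonneg ha, norm_mul,
      norm_expWeight _ hσ]
    gcongr
    exact norm_cpow_neg_le (by linarith) hδ ((hball z hz).2 σ hσ'.le)
  · filter_upwards [ae_restrict_mem measurableSet_Ioi] with σ hσ z hz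
    have hσ' : 0 < σ := hσ
    have h := ((hasDerivAt_add_cpow a (add_ofReal_mem_slitPlane (hball z hz).1 hσ'.le)).comp_add_const
      z (σ : ℂ)).const_mul ((Real.exp (-σ) * σ ^ ((5 / 6 : ℝ) - 1) : ℝ) : ℂ)
    refine h.congr_deriv ?_
    ring

/-- The confluent hypergeometric equation satisfied by `shiftedLaplace (1 / 6)`. -/
lemma shiftedLaplace_ode {w : ℂ} (hw : w ∈ slitPlane) :
    7 / 18 * w * shiftedLaplace (13 / 6) w + (w / 3 - 1 / 9) * shiftedLaplace (7 / 6) w -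
      1 / 3 * shiftedLaplace (1 / 6) w = 0 := by
  have h1 := (integrableOn_shiftedLaplace (a := 13 / 6) (by norm_num) hw).const_mul (7 / 18 * w)
  have h2 := (integrableOn_shiftedLaplace (a := 7 / 6) (by norm_num) hw).const_mul (w / 3 - 1 / 9)
  have h3 := (integrableOn_shiftedLaplace (a := 1 / 6) (by norm_num) hw).const_mul (1 / 3 : ℂ)
  have hw0 : ∀ {σ : ℝ}, 0 ≤ σ → w + σ ≠ 0 := fun hσ =>
    slitPlane_ne_zero (add_ofReal_mem_slitPlane hw hσ)
  obtain ⟨δ, hδ, hball⟩ := exists_ball_norm_add_ge hw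
  have hcont : ContinuousWithinAt (fun σ : ℝ => ((1 / 3 * (Real.exp (-σ) * σ ^ (5 / 6 : ℝ)) : ℝ) : ℂ) *
      (w + σ) ^ ((-(7 / 6) : ℝ) : ℂ)) (Ici 0) 0 := by
    refine ContinuousAt.continuousWithinAt (ContinuousAt.mul ?_ ?_)
    · refine Complex.continuous_ofReal.continuousAt.comp ?_
      exact ContinuousAt.mul continuousAt_const (ContinuousAt.mul (by fun_prop)
        (Real.continuousAt_rpow_const _ _ (Or.inr (by norm_num))))
    · exact (continuousAt_cpow_const (add_ofReal_mem_slitPlane hw le_rfl)).comp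
        (f := fun σ : ℝ => w + σ) (by fun_prop)
  have hder : ∀ σ ∈ Ioi (0 : ℝ), HasDerivAt
      (fun σ : ℝ => ((1 / 3 * (Real.exp (-σ) * σ ^ (5 / 6 : ℝ)) : ℝ) : ℂ) *
        (w + σ) ^ ((-(7 / 6) : ℝ) : ℂ))
      (7 / 18 * w * (((Real.exp (-σ) * σ ^ ((5 / 6 : ℝ) - 1) : ℝ) : ℂ) *
        (w + σ) ^ ((-(13 / 6) : ℝ) : ℂ)) +
       (w / 3 - 1 / 9) * (((Real.exp (-σ) * σ ^ ((5 / 6 : ℝ) - 1) : ℝ) : ℂ) *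
        (w + σ) ^ ((-(7 / 6) : ℝ) : ℂ)) -
       1 / 3 * (((Real.exp (-σ) * σ ^ ((5 / 6 : ℝ) - 1) : ℝ) : ℂ) *
        (w + σ) ^ ((-(1 / 6) : ℝ) : ℂ))) σ := by
    intro σ (hσ : 0 < σ)
    have d1 : HasDerivAt (fun σ : ℝ => 1 / 3 * (Real.exp (-σ) * σ ^ (5 / 6 : ℝ)))
        (1 / 3 * (Real.exp (-σ) * -1 * σ ^ (5 / 6 : ℝ) +
          Real.exp (-σ) * (5 / 6 * σ ^ ((5 / 6 : ℝ) - 1)))) σ :=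
      (((hasDerivAt_neg σ).exp).mul (Real.hasDerivAt_rpow_const (Or.inl hσ.ne'))).const_mul _
    have d2 : HasDerivAt (fun σ : ℝ => (w + σ) ^ ((-(7 / 6) : ℝ) : ℂ))
        (-((7 / 6 : ℝ) : ℂ) * (w + σ) ^ ((-(7 / 6 + 1) : ℝ) : ℂ)) σ :=
      ((hasDerivAt_add_cpow (7 / 6) (add_ofReal_mem_slitPlane hw hσ.le)).comp_const_add
        w (σ : ℂ)).comp_ofReal
    refine (d1.ofReal_comp.mul d2).congr_deriv ?_
    have e1 : σ ^ (5 / 6 : ℝ) = σ * σ ^ ((5 / 6 : ℝ) - 1) := by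
      rw [Real.rpow_sub_one hσ.ne']; field_simp
    have e2 : (w + σ) ^ ((-(7 / 6) : ℝ) : ℂ) = (w + σ) * (w + σ) ^ ((-(13 / 6) : ℝ) : ℂ) := by
      rw [show ((-(7 / 6) : ℝ) : ℂ) = ((-(13 / 6) : ℝ) : ℂ) + 1 by push_cast; ring,
        Complex.cpow_add _ _ (hw0 hσ.le), Complex.cpow_one, mul_comm]
    have e3 : (w + σ) ^ ((-(1 / 6) : ℝ) : ℂ) = (w + σ) ^ 2 * (w + σ) ^ ((-(13 / 6) : ℝ) : ℂ) := by
      rw [show ((-(1 / 6) : ℝ) : ℂ) = ((-(13 / 6) : ℝ) : ℂ) + (2 : ℕ) by push_cast; ring,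
        Complex.cpow_add _ _ (hw0 hσ.le), Complex.cpow_natCast, mul_comm]
    rw [e1, e2, e3, show (-(7 / 6 + 1) : ℝ) = -(13 / 6) by norm_num]
    generalize (w + σ) ^ ((-(13 / 6) : ℝ) : ℂ) = X
    push_cast
    generalize ((σ ^ ((5 / 6 : ℝ) - 1) : ℝ) : ℂ) = Y
    ring
  have hlim : Tendsto (fun σ : ℝ => ((1 / 3 * (Real.exp (-σ) * σ ^ (5 / 6 : ℝ)) : ℝ) : ℂ) *
        (w + σ) ^ ((-(7 / 6) : ℝ) : ℂ)) atTop (𝓝 0) := by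
    have hz : Tendsto (fun σ : ℝ => 1 / 3 * (σ ^ (5 / 6 : ℝ) * Real.exp (-1 * σ)) * δ ^ (-(7 / 6 : ℝ)))
        atTop (𝓝 0) := by
      have := ((tendsto_rpow_mul_exp_neg_mul_atTop_nhds_zero (5 / 6) 1 one_pos).const_mul
        (1 / 3)).mul_const (δ ^ (-(7 / 6 : ℝ)))
      simpa using! this
    refine squeeze_zero_norm' ?_ hz
    filter_upwards [eventually_gt_atTop 0] with σ hσ
    rw [norm_mul, Complex.norm_real, Real.norm_of_nonneg (by positivity), mul_comm (Real.exp _),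
      neg_one_mul]
    gcongr
    exact norm_cpow_neg_le (by norm_num) hδ ((hball w (Metric.mem_ball_self hδ)).2 σ hσ.le)
  have h := integral_Ioi_of_hasDerivAt_of_tendsto hcont hder ((h1.add h2).sub h3) hlim
  rw [integral_sub (by exact h1.add h2) (by exact h3), integral_add (by exact h1) (by exact h2),
    integral_const_mul, integral_const_mul, integral_const_mul] at h
  simpa [shiftedLaplace] using! h

lemma re_cpow_neg_sixth_pos {z : ℂ} (hz : z ≠ 0) : 0 < (z ^ ((-(1 / 6) : ℝ) : ℂ)).re := by
  rw [Complex.cpow_def_of_ne_zero hz, Complex.exp_re]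
  refine mul_pos (Real.exp_pos _) (Real.cos_pos_of_mem_Ioo ?_)
  rw [Complex.im_mul_ofReal, Complex.log_im]
  have h1 := Complex.neg_pi_lt_arg z
  have h2 := Complex.arg_le_pi z
  constructor <;> linarith [Real.pi_pos]

lemma re_integral_pos {f : ℝ → ℂ} (hf : IntegrableOn f (Ioi 0)) (hpos : ∀ σ > 0, 0 < (f σ).re) :
    0 < (∫ σ in Ioi (0 : ℝ), f σ).re := by
  have h : (∫ σ in Ioi (0 : ℝ), f σ).re = ∫ σ in Ioi (0 : ℝ), (f σ).re := (integral_re hf).symm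
  rw [h, setIntegral_pos_iff_support_of_nonneg_ae ?_ (by exact hf.re)]
  · have : (Function.support fun σ => (f σ).re) ∩ Ioi 0 = Ioi 0 :=
      inter_eq_right.2 fun σ hσ => (hpos σ hσ).ne'
    refine lt_of_lt_of_eq ?_ (congrArg volume this.symm)
    simp
  · filter_upwards [ae_restrict_mem measurableSet_Ioi] with σ hσ
    exact (hpos σ hσ).le

lemma re_shiftedLaplace_pos {w : ℂ} (hw : w ∈ slitPlane) : 0 < (shiftedLaplace (1 / 6) w).re := by
  refine re_integral_pos (integrableOn_shiftedLaplace (by norm_num) hw) fun σ hσ => ?_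
  rw [Complex.re_ofReal_mul]
  exact mul_pos (by positivity)
    (re_cpow_neg_sixth_pos (slitPlane_ne_zero (add_ofReal_mem_slitPlane hw hσ.le)))

lemma shiftedLaplace_conj (a : ℝ) {w : ℂ} (hw : w ∈ slitPlane) :
    shiftedLaplace a (starRingEnd ℂ w) = starRingEnd ℂ (shiftedLaplace a w) := by
  rw [shiftedLaplace, shiftedLaplace, ← integral_conj]
  refine setIntegral_congr_fun measurableSet_Ioi fun σ hσ => ?_
  have h := mem_slitPlane_iff_arg.1 (add_ofReal_mem_slitPlane hw (le_of_lt hσ))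
  simp only [map_mul, Complex.conj_ofReal]
  rw [← Complex.conj_ofReal (-a), ← Complex.conj_cpow _ _ h.1, map_add, Complex.conj_ofReal,
    Complex.conj_ofReal]

/-! ### The smooth phase function -/

/-- The integral `∫₀^∞ e^{-σ} σ^{k-1/6} (1 + iεσ)^{-k-1/6} dσ`. -/
noncomputable def phaseLaplace (k : ℕ) (ε : ℝ) : ℂ :=
  ∫ σ in Ioi (0 : ℝ), ((Real.exp (-σ) * σ ^ (((k : ℝ) + 5 / 6) - 1) : ℝ) : ℂ) *
    (1 + Complex.I * ε * σ) ^ ((-((k : ℝ) + 1 / 6) : ℝ) : ℂ)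

lemma one_add_I_mul_mem_slitPlane (ε σ : ℝ) : 1 + Complex.I * ε * σ ∈ slitPlane := by
  rw [mem_slitPlane_iff]; left; simp

lemma one_le_norm_one_add_I_mul (ε σ : ℝ) : 1 ≤ ‖1 + Complex.I * ε * σ‖ := by
  have h := Complex.re_le_norm (1 + Complex.I * ε * σ)
  simpa using h

lemma norm_phaseLaplace_integrand_le (k : ℕ) (ε : ℝ) {σ : ℝ} (hσ : 0 < σ) :
    ‖((Real.exp (-σ) * σ ^ (((k : ℝ) + 5 / 6) - 1) : ℝ) : ℂ) *
      (1 + Complex.I * ε * σ) ^ ((-((k : ℝ) + 1 / 6) : ℝ) : ℂ)‖ ≤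
      Real.exp (-σ) * σ ^ (((k : ℝ) + 5 / 6) - 1) := by
  rw [norm_mul, norm_expWeight _ hσ]
  refine mul_le_of_le_one_right (by positivity) ?_
  simpa using norm_cpow_neg_le (a := (k : ℝ) + 1 / 6) (by positivity) one_pos
    (one_le_norm_one_add_I_mul ε σ)

lemma aestronglyMeasurable_phaseLaplace (k : ℕ) (ε : ℝ) :
    AEStronglyMeasurable (fun σ : ℝ => ((Real.exp (-σ) * σ ^ (((k : ℝ) + 5 / 6) - 1) : ℝ) : ℂ) *
      (1 + Complex.I * ε * σ) ^ ((-((k : ℝ) + 1 / 6) : ℝ) : ℂ)) (volume.restrict (Ioi 0)) := by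
  refine ContinuousOn.aestronglyMeasurable ?_ measurableSet_Ioi
  exact (continuousOn_expWeight _).mul (ContinuousOn.cpow_const (by fun_prop)
    fun σ _ => one_add_I_mul_mem_slitPlane ε σ)

lemma integrableOn_expWeight (k : ℕ) :
    IntegrableOn (fun σ : ℝ => Real.exp (-σ) * σ ^ (((k : ℝ) + 5 / 6) - 1)) (Ioi 0) :=
  Real.GammaIntegral_convergent (by positivity)

lemma integrableOn_phaseLaplace (k : ℕ) (ε : ℝ) :
    IntegrableOn (fun σ : ℝ => ((Real.exp (-σ) * σ ^ (((k : ℝ) + 5 / 6) - 1) : ℝ) : ℂ) *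
      (1 + Complex.I * ε * σ) ^ ((-((k : ℝ) + 1 / 6) : ℝ) : ℂ)) (Ioi 0) := by
  refine Integrable.mono' (integrableOn_expWeight k) (aestronglyMeasurable_phaseLaplace k ε) ?_
  filter_upwards [ae_restrict_mem measurableSet_Ioi] with σ hσ
  exact norm_phaseLaplace_integrand_le k ε hσ

lemma hasDerivAt_phaseLaplace (k : ℕ) (ε : ℝ) :
    HasDerivAt (phaseLaplace k)
      (-(((k : ℝ) + 1 / 6 : ℝ) : ℂ) * Complex.I * phaseLaplace (k + 1) ε) ε := by
  have key := (hasDerivAt_integral_of_dominated_loc_of_deriv_le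
    (μ := volume.restrict (Ioi (0 : ℝ)))
    (F := fun (ε : ℝ) (σ : ℝ) => ((Real.exp (-σ) * σ ^ (((k : ℝ) + 5 / 6) - 1) : ℝ) : ℂ) *
      (1 + Complex.I * ε * σ) ^ ((-((k : ℝ) + 1 / 6) : ℝ) : ℂ))
    (F' := fun (ε : ℝ) (σ : ℝ) => -(((k : ℝ) + 1 / 6 : ℝ) : ℂ) * Complex.I *
      (((Real.exp (-σ) * σ ^ ((((k + 1 : ℕ) : ℝ) + 5 / 6) - 1) : ℝ) : ℂ) *
      (1 + Complex.I * ε * σ) ^ ((-(((k + 1 : ℕ) : ℝ) + 1 / 6) : ℝ) : ℂ)))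
    (Metric.ball_mem_nhds ε one_pos)
    (Filter.Eventually.of_forall fun _ => aestronglyMeasurable_phaseLaplace k _)
    (integrableOn_phaseLaplace k ε)
    ((aestronglyMeasurable_phaseLaplace (k + 1) ε).const_mul _) ?_
    ((integrableOn_expWeight (k + 1)).const_mul ((k : ℝ) + 1 / 6)) ?_).2
  · rw [integral_const_mul] at key
    exact key
  · filter_upwards [ae_restrict_mem measurableSet_Ioi] with σ hσ x _
    rw [norm_mul, norm_mul, norm_neg, Complex.norm_real, Real.norm_of_nonneg (by positivity),
      Complex.norm_I, mul_one]
    exact mul_le_mul_of_nonneg_left (norm_phaseLaplace_integrand_le (k + 1) x hσ) (by positivity)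
  · filter_upwards [ae_restrict_mem measurableSet_Ioi] with σ hσ x _
    have hσ' : 0 < σ := hσ
    have h1 : HasDerivAt (fun z : ℂ => 1 + Complex.I * z * σ) (Complex.I * σ) (x : ℂ) := by
      have := (((hasDerivAt_id (x : ℂ)).const_mul Complex.I).mul_const (σ : ℂ)).const_add 1
      simpa using! this
    have h2 := ((hasDerivAt_add_cpow ((k : ℝ) + 1 / 6)
      (one_add_I_mul_mem_slitPlane x σ)).comp (x : ℂ) h1).comp_ofReal.const_mul
        ((Real.exp (-σ) * σ ^ (((k : ℝ) + 5 / 6) - 1) : ℝ) : ℂ)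
    refine h2.congr_deriv ?_
    have e1 : σ ^ ((((k + 1 : ℕ) : ℝ) + 5 / 6) - 1) = σ * σ ^ (((k : ℝ) + 5 / 6) - 1) := by
      rw [show ((((k + 1 : ℕ) : ℝ) + 5 / 6) - 1) = (((k : ℝ) + 5 / 6) - 1) + 1 by push_cast; ring,
        Real.rpow_add_one hσ'.ne', mul_comm]
    have e2 : -(((k + 1 : ℕ) : ℝ) + 1 / 6) = -((k : ℝ) + 1 / 6 + 1) := by push_cast; ring
    rw [e1, e2]
    generalize (1 + Complex.I * x * σ) ^ ((-((k : ℝ) + 1 / 6 + 1) : ℝ) : ℂ) = X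
    rw [Complex.ofReal_mul, Complex.ofReal_mul, Complex.ofReal_mul]
    ring

lemma contDiff_phaseLaplace (n k : ℕ) : ContDiff ℝ n (phaseLaplace k) := by
  induction n generalizing k with
  | zero =>
    exact contDiff_zero.2 (continuous_iff_continuousAt.2 fun ε =>
      (hasDerivAt_phaseLaplace k ε).continuousAt)
  | succ n ih =>
    push_cast
    refine contDiff_succ_iff_deriv.2 ⟨fun ε => (hasDerivAt_phaseLaplace k ε).differentiableAt,
      fun h => by simp at h, ?_⟩
    rw [show deriv (phaseLaplace k) = fun ε =>
      -(((k : ℝ) + 1 / 6 : ℝ) : ℂ) * Complex.I * phaseLaplace (k + 1) ε from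
      funext fun ε => (hasDerivAt_phaseLaplace k ε).deriv]
    exact contDiff_const.mul (ih _)

lemma re_phaseLaplace_pos (ε : ℝ) : 0 < (phaseLaplace 0 ε).re := by
  refine re_integral_pos (integrableOn_phaseLaplace 0 ε) fun σ hσ => ?_
  rw [Complex.re_ofReal_mul]
  refine mul_pos (by positivity) ?_
  have := re_cpow_neg_sixth_pos (slitPlane_ne_zero (one_add_I_mul_mem_slitPlane ε σ))
  simpa using this

lemma phaseLaplace_zero_right (k : ℕ) :
    phaseLaplace k 0 = ((Real.Gamma (k + 5 / 6) : ℝ) : ℂ) := by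
  rw [Real.Gamma_eq_integral (by positivity), ← integral_complex_ofReal]
  simp [phaseLaplace]

/-- The argument of `phaseLaplace 0`. -/
noncomputable def airyPhase (ε : ℝ) : ℝ := (Complex.log (phaseLaplace 0 ε)).im

lemma phaseLaplace_mem_slitPlane (ε : ℝ) : phaseLaplace 0 ε ∈ slitPlane :=
  mem_slitPlane_iff.2 (Or.inl (re_phaseLaplace_pos ε))

lemma contDiff_airyPhase (n : ℕ) : ContDiff ℝ n airyPhase := by
  have hlog : ContDiff ℝ n (fun ε => Complex.log (phaseLaplace 0 ε)) := by
    refine contDiff_iff_contDiffAt.2 fun ε => ?_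
    have h : ContDiffAt ℂ n Complex.log (phaseLaplace 0 ε) :=
      Complex.contDiffAt_log (phaseLaplace_mem_slitPlane ε)
    exact (h.restrict_scalars ℝ).comp ε (contDiff_phaseLaplace n 0).contDiffAt
  exact Complex.imCLM.contDiff.comp hlog

lemma airyPhase_zero : airyPhase 0 = 0 := by
  rw [airyPhase, phaseLaplace_zero_right, Complex.log_im, Complex.arg_ofReal_of_nonneg]
  exact (Real.Gamma_pos_of_pos (by norm_num)).le

lemma exists_hasDerivAt_airyPhase_zero : ∃ d < 0, HasDerivAt airyPhase d 0 := by
  have h := (hasDerivAt_phaseLaplace 0 0).clog_real (phaseLaplace_mem_slitPlane 0)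
  have h' := Complex.imCLM.hasFDerivAt.comp_hasDerivAt (0 : ℝ) h
  refine ⟨_, ?_, h'⟩
  have g0 := Real.Gamma_pos_of_pos (s := ((0 : ℕ) : ℝ) + 5 / 6) (by norm_num)
  have g1 := Real.Gamma_pos_of_pos (s := ((0 + 1 : ℕ) : ℝ) + 5 / 6) (by norm_num)
  rw [phaseLaplace_zero_right, phaseLaplace_zero_right, Complex.imCLM_apply,
    Complex.div_ofReal_im, Complex.im_mul_ofReal]
  refine div_neg_of_neg_of_pos (mul_neg_of_neg_of_pos ?_ g1) g0
  simp

lemma abs_airyPhase_lt (ε : ℝ) : |airyPhase ε| < Real.pi / 2 := by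
  rw [airyPhase, Complex.log_im]
  exact Complex.abs_arg_lt_pi_div_two_iff.2 (Or.inl (re_phaseLaplace_pos ε))

lemma conj_phaseLaplace_div (ε : ℝ) :
    starRingEnd ℂ (phaseLaplace 0 ε) / phaseLaplace 0 ε =
      Complex.exp (-(2 * airyPhase ε : ℝ) * Complex.I) := by
  have h0 := slitPlane_ne_zero (phaseLaplace_mem_slitPlane ε)
  have h1 := Complex.log_conj _ (Complex.slitPlane_arg_ne_pi (phaseLaplace_mem_slitPlane ε))
  have h2 : starRingEnd ℂ (phaseLaplace 0 ε) / phaseLaplace 0 ε =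
      Complex.exp (starRingEnd ℂ (Complex.log (phaseLaplace 0 ε)) -
        Complex.log (phaseLaplace 0 ε)) := by
    rw [← h1, Complex.exp_sub, Complex.exp_log ((map_ne_zero _).2 h0), Complex.exp_log h0]
  rw [h2]
  congr 1
  apply Complex.ext <;> simp [airyPhase]
  ring

lemma shiftedLaplace_neg_I_mul {t : ℝ} (ht : 0 < t) :
    shiftedLaplace (1 / 6) (-(Complex.I * t)) =
      ((t ^ (-(1 / 6) : ℝ) : ℝ) : ℂ) * Complex.exp ((Real.pi / 12 : ℝ) * Complex.I) *
        phaseLaplace 0 t⁻¹ := by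
  rw [shiftedLaplace, phaseLaplace, ← integral_const_mul]
  refine setIntegral_congr_fun measurableSet_Ioi fun σ (hσ : 0 < σ) => ?_
  have ht0 : (t : ℂ) ≠ 0 := by exact_mod_cast ht.ne'
  set z : ℂ := 1 + Complex.I * (t⁻¹ : ℝ) * σ with hz
  have hz0 : z ≠ 0 := slitPlane_ne_zero (one_add_I_mul_mem_slitPlane _ _)
  have hfac : -(Complex.I * t) + σ = t * (-Complex.I * z) := by
    rw [hz]; push_cast; field_simp
    linear_combination (σ : ℂ) * Complex.I_sq
  have harg : 0 ≤ arg z := by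
    rw [Complex.arg_nonneg_iff]
    simp [hz]; positivity
  have hlog : Complex.log (-(Complex.I * t) + σ) =
      (Real.log t : ℂ) + (-(Real.pi / 2) * Complex.I + Complex.log z) := by
    rw [hfac, Complex.log_ofReal_mul ht (mul_ne_zero (neg_ne_zero.2 I_ne_zero) hz0),
      (Complex.log_mul_eq_add_log_iff (neg_ne_zero.2 I_ne_zero) hz0).2, Complex.log_neg_I]
    · rw [Complex.arg_neg_I]
      constructor <;> linarith [Complex.arg_le_pi z, Real.pi_pos]
  have hne : -(Complex.I * t) + σ ≠ 0 := by
    rw [hfac]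
    exact mul_ne_zero ht0 (mul_ne_zero (neg_ne_zero.2 I_ne_zero) hz0)
  have hpow : (-(Complex.I * t) + σ) ^ ((-(1 / 6) : ℝ) : ℂ) =
      ((t ^ (-(1 / 6) : ℝ) : ℝ) : ℂ) * Complex.exp ((Real.pi / 12 : ℝ) * Complex.I) *
        z ^ ((-(1 / 6) : ℝ) : ℂ) := by
    rw [Complex.cpow_def_of_ne_zero hne, Complex.cpow_def_of_ne_zero hz0, hlog,
      Real.rpow_def_of_pos ht, Complex.ofReal_exp, ← Complex.exp_add, ← Complex.exp_add]
    congr 1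
    push_cast
    ring
  simp only [hpow, Nat.cast_zero, zero_add]
  ring

/-! ### The connection formula -/

/-- The sector `|arg v| < π/4`. -/
def quarterSector : Set ℂ := {v | |v.im| < v.re}

lemma isOpen_quarterSector : IsOpen quarterSector :=
  isOpen_lt (by fun_prop) (by fun_prop)

lemma isPreconnected_quarterSector : IsPreconnected quarterSector := by
  refine Convex.isPreconnected (convex_iff_add_mem.2 ?_)
  intro x (hx : |x.im| < x.re) y (hy : |y.im| < y.re) a b ha hb hab
  change |(a • x + b • y).im| < (a • x + b • y).re
  simp only [Complex.add_im, Complex.add_re, Complex.smul_im, Complex.smul_re, smul_eq_mul]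
  rw [abs_lt] at *
  rcases ha.eq_or_lt with rfl | ha'
  · obtain rfl : b = 1 := by linarith
    constructor <;> linarith
  · constructor <;> nlinarith

lemma ofReal_mem_quarterSector {x : ℝ} (hx : 0 < x) : (x : ℂ) ∈ quarterSector := by
  simpa [quarterSector] using hx

lemma cube_mem_slitPlane {v : ℂ} (hv : v ∈ quarterSector) : 4 / 3 * v ^ 3 ∈ slitPlane := by
  have h : |v.im| < v.re := hv
  have hre : 0 < v.re := (abs_nonneg _).trans_lt h
  have h2 : v.im ^ 2 < v.re ^ 2 := sq_lt_sq' (abs_lt.1 h).1 (abs_lt.1 h).2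
  have e : 4 / 3 * v ^ 3 = ((4 / 3 * (v.re ^ 3 - 3 * v.re * v.im ^ 2) : ℝ) : ℂ) +
      ((4 / 3 * (v.im * (3 * v.re ^ 2 - v.im ^ 2)) : ℝ) : ℂ) * Complex.I := by
    conv_lhs => rw [← Complex.re_add_im v]
    push_cast
    linear_combination (4 * (v.re : ℂ) * v.im ^ 2 + 4 / 3 * (v.im : ℂ) ^ 3 * Complex.I) *
      Complex.I_sq
  rw [e, mem_slitPlane_iff, Complex.add_re, Complex.add_im, Complex.re_ofReal_mul,
    Complex.im_ofReal_mul, Complex.ofReal_re, Complex.ofReal_im, Complex.I_re, Complex.I_im]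
  by_cases him : v.im = 0
  · left
    rw [him]
    ring_nf
    positivity
  · right
    have : 3 * v.re ^ 2 - v.im ^ 2 ≠ 0 := by nlinarith [sq_nonneg v.re]
    simp [him, this]

/-- The function `v ↦ e^{-(2/3) v³} I((4/3) v³)`, proportional to `Ai(v²)`. -/
noncomputable def airyProfile (v : ℂ) : ℂ :=
  Complex.exp (-(2 / 3) * v ^ 3) * shiftedLaplace (1 / 6) (4 / 3 * v ^ 3)

/-- The companion of `airyProfile`, proportional to the derivative of `Ai` at `v²`. -/
noncomputable def airyProfileDeriv (v : ℂ) : ℂ :=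
  -(v * Complex.exp (-(2 / 3) * v ^ 3)) *
    (shiftedLaplace (1 / 6) (4 / 3 * v ^ 3) + 1 / 3 * shiftedLaplace (7 / 6) (4 / 3 * v ^ 3))

lemma hasDerivAt_shiftedLaplace_cube {a : ℝ} (ha : 0 ≤ a) {v : ℂ} (hv : v ∈ quarterSector) :
    HasDerivAt (fun v : ℂ => shiftedLaplace a (4 / 3 * v ^ 3))
      (-(a : ℂ) * shiftedLaplace (a + 1) (4 / 3 * v ^ 3) * (4 * v ^ 2)) v := by
  have h := (hasDerivAt_shiftedLaplace ha (cube_mem_slitPlane hv)).comp v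
    ((hasDerivAt_pow 3 v).const_mul (4 / 3))
  refine h.congr_deriv ?_
  push_cast
  ring

lemma hasDerivAt_exp_cube (v : ℂ) : HasDerivAt (fun v : ℂ => Complex.exp (-(2 / 3) * v ^ 3))
    (Complex.exp (-(2 / 3) * v ^ 3) * (-2 * v ^ 2)) v := by
  refine (((hasDerivAt_pow 3 v).const_mul (-(2 / 3))).cexp).congr_deriv ?_
  push_cast
  ring

lemma hasDerivAt_airyProfile {v : ℂ} (hv : v ∈ quarterSector) :
    HasDerivAt airyProfile (2 * v * airyProfileDeriv v) v := by
  have h := (hasDerivAt_exp_cube v).mul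
    (hasDerivAt_shiftedLaplace_cube (a := 1 / 6) (by norm_num) hv)
  refine h.congr_deriv ?_
  rw [airyProfileDeriv, show (1 / 6 + 1 : ℝ) = 7 / 6 by norm_num]
  push_cast
  ring

lemma hasDerivAt_airyProfileDeriv {v : ℂ} (hv : v ∈ quarterSector) :
    HasDerivAt airyProfileDeriv (2 * v * (v ^ 2 * airyProfile v)) v := by
  have h := (((hasDerivAt_id v).mul (hasDerivAt_exp_cube v)).neg).mul
    ((hasDerivAt_shiftedLaplace_cube (a := 1 / 6) (by norm_num) hv).add
      ((hasDerivAt_shiftedLaplace_cube (a := 7 / 6) (by norm_num) hv).const_mul (1 / 3)))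
  refine h.congr_deriv ?_
  have hode := shiftedLaplace_ode (cube_mem_slitPlane hv)
  rw [airyProfile, show (1 / 6 + 1 : ℝ) = 7 / 6 by norm_num,
    show (7 / 6 + 1 : ℝ) = 13 / 6 by norm_num]
  simp only [id, Pi.mul_apply, Pi.neg_apply, Pi.add_apply]
  push_cast
  linear_combination 3 * Complex.exp (-(2 / 3) * v ^ 3) * hode

lemma airyProfile_ne_zero {v : ℂ} (hv : v ∈ quarterSector) : airyProfile v ≠ 0 := by
  refine mul_ne_zero (Complex.exp_ne_zero _) fun h => ?_
  have := re_shiftedLaplace_pos (cube_mem_slitPlane hv)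
  rw [h] at this
  simp at this

lemma airyProfile_conj {v : ℂ} (hv : v ∈ quarterSector) :
    airyProfile (starRingEnd ℂ v) = starRingEnd ℂ (airyProfile v) := by
  have h2 : (starRingEnd ℂ) (2 : ℂ) = 2 := Complex.conj_ofNat 2
  have h3 : (starRingEnd ℂ) (3 : ℂ) = 3 := Complex.conj_ofNat 3
  have h4 : (starRingEnd ℂ) (4 : ℂ) = 4 := Complex.conj_ofNat 4
  rw [airyProfile, airyProfile, map_mul, ← shiftedLaplace_conj _ (cube_mem_slitPlane hv),
    ← Complex.exp_conj]
  simp only [map_mul, map_neg, map_div₀, map_pow, h2, h3, h4]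

lemma norm_shiftedLaplace_le {a : ℝ} (ha : 0 ≤ a) {x : ℝ} (hx : 1 ≤ x) :
    ‖shiftedLaplace a x‖ ≤ Real.Gamma (5 / 6) := by
  rw [Real.Gamma_eq_integral (by norm_num)]
  refine norm_integral_le_of_norm_le (Real.GammaIntegral_convergent (by norm_num)) ?_
  filter_upwards [ae_restrict_mem measurableSet_Ioi] with σ hσ
  have hσ' : 0 < σ := hσ
  rw [norm_mul, norm_expWeight _ hσ]
  refine mul_le_of_le_one_right (by positivity) ?_
  have h1 : 1 ≤ ‖(x : ℂ) + σ‖ := by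
    rw [← Complex.ofReal_add, Complex.norm_real, Real.norm_of_nonneg] <;> linarith
  simpa using norm_cpow_neg_le ha one_pos h1

/-- The Wronskian of `airyProfile` with a solution of the Airy equation is constant. -/
lemma wronskian_airyProfile_const {q q' : ℂ → ℂ} (hq : ∀ z, HasDerivAt q (q' z) z)
    (hq' : ∀ z, HasDerivAt q' (z * q z) z) {v w : ℂ} (hv : v ∈ quarterSector)
    (hw : w ∈ quarterSector) :
    airyProfile v * q' (v ^ 2) - airyProfileDeriv v * q (v ^ 2) =
      airyProfile w * q' (w ^ 2) - airyProfileDeriv w * q (w ^ 2) := by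
  have hd : ∀ v ∈ quarterSector, HasDerivAt
      (fun v => airyProfile v * q' (v ^ 2) - airyProfileDeriv v * q (v ^ 2)) 0 v := by
    intro v hv
    have h := ((hasDerivAt_airyProfile hv).mul ((hq' (v ^ 2)).comp v (hasDerivAt_pow 2 v))).sub
      ((hasDerivAt_airyProfileDeriv hv).mul ((hq (v ^ 2)).comp v (hasDerivAt_pow 2 v)))
    refine h.congr_deriv ?_
    simp only [Function.comp]
    push_cast
    ring
  exact isOpen_quarterSector.is_const_of_deriv_eq_zero isPreconnected_quarterSector
    (fun v hv => (hd v hv).differentiableAt.differentiableWithinAt)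
    (fun v hv => (hd v hv).deriv) hv hw

lemma wronskian_airyProfile_eq_zero {q q' : ℂ → ℂ} (hq : ∀ z, HasDerivAt q (q' z) z)
    (hq' : ∀ z, HasDerivAt q' (z * q z) z) {M : ℝ}
    (hM : ∀ x : ℝ, 0 ≤ x → ‖q x‖ ≤ M ∧ ‖q' x‖ ≤ M) {v : ℂ} (hv : v ∈ quarterSector) :
    airyProfile v * q' (v ^ 2) - airyProfileDeriv v * q (v ^ 2) = 0 := by
  have hlim : Tendsto (fun x : ℝ => airyProfile x * q' ((x : ℂ) ^ 2) -
      airyProfileDeriv x * q ((x : ℂ) ^ 2)) atTop (𝓝 0) := by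
    have hz : Tendsto (fun x : ℝ => 3 * Real.Gamma (5 / 6) * M *
        (x ^ (1 : ℝ) * Real.exp (-(2 / 3) * x))) atTop (𝓝 0) := by
      simpa using! (tendsto_rpow_mul_exp_neg_mul_atTop_nhds_zero 1 (2 / 3)
        (by norm_num)).const_mul (3 * Real.Gamma (5 / 6) * M)
    refine squeeze_zero_norm' ?_ hz
    filter_upwards [eventually_ge_atTop 1] with x hx
    have hx0 : 0 < x := by linarith
    have hM0 : 0 ≤ M := (norm_nonneg _).trans (hM 0 le_rfl).1
    have hG : 0 < Real.Gamma (5 / 6) := Real.Gamma_pos_of_pos (by norm_num)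
    obtain ⟨hq1, hq2⟩ := hM (x ^ 2) (by positivity)
    have hw1 : (1 : ℝ) ≤ 4 / 3 * x ^ 3 := by nlinarith [one_le_pow₀ (n := 3) hx]
    have hI6 := norm_shiftedLaplace_le (a := 1 / 6) (by norm_num) hw1
    have hI7 := norm_shiftedLaplace_le (a := 7 / 6) (by norm_num) hw1
    push_cast at hq1 hq2 hI6 hI7
    have hexp : ‖Complex.exp (-(2 / 3) * (x : ℂ) ^ 3)‖ ≤ Real.exp (-(2 / 3) * x) := by
      rw [show (-(2 / 3) * (x : ℂ) ^ 3) = ((-(2 / 3) * x ^ 3 : ℝ) : ℂ) by push_cast; ring,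
        Complex.norm_exp_ofReal, Real.exp_le_exp]
      nlinarith [pow_le_pow_right₀ hx (show 1 ≤ 3 by norm_num)]
    have hφ : ‖airyProfile x‖ ≤ Real.exp (-(2 / 3) * x) * Real.Gamma (5 / 6) := by
      rw [airyProfile, norm_mul]
      gcongr
    have hψ : ‖airyProfileDeriv x‖ ≤ x * Real.exp (-(2 / 3) * x) * (2 * Real.Gamma (5 / 6)) := by
      rw [airyProfileDeriv, norm_mul, norm_neg, norm_mul, Complex.norm_real,
        Real.norm_of_nonneg hx0.le]
      gcongr
      refine (norm_add_le _ _).trans ?_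
      rw [norm_mul, show ‖(1 / 3 : ℂ)‖ = 1 / 3 by simp]
      linarith
    calc _ ≤ ‖airyProfile x‖ * ‖q' ((x : ℂ) ^ 2)‖ + ‖airyProfileDeriv x‖ * ‖q ((x : ℂ) ^ 2)‖ := by
          rw [← norm_mul, ← norm_mul]; exact norm_sub_le _ _
      _ ≤ Real.exp (-(2 / 3) * x) * Real.Gamma (5 / 6) * M +
          x * Real.exp (-(2 / 3) * x) * (2 * Real.Gamma (5 / 6)) * M := by gcongr
      _ ≤ x * (Real.exp (-(2 / 3) * x) * Real.Gamma (5 / 6) * M) +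
          x * Real.exp (-(2 / 3) * x) * (2 * Real.Gamma (5 / 6)) * M := by
          have := le_mul_of_one_le_left
            (show 0 ≤ Real.exp (-(2 / 3) * x) * Real.Gamma (5 / 6) * M by positivity) hx
          linarith
      _ = _ := by rw [Real.rpow_one]; ring
  refine tendsto_nhds_unique ((tendsto_const_nhds).congr' ?_) hlim
  filter_upwards [eventually_gt_atTop 0] with x hx
  exact wronskian_airyProfile_const hq hq' hv (ofReal_mem_quarterSector hx)

lemma exists_eq_mul_airyProfile {Ai Ai' : ℂ → ℂ} (hA : ∀ z, HasDerivAt Ai (Ai' z) z)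
    (hA' : ∀ z, HasDerivAt Ai' (z * Ai z) z)
    (h0 : Ai 0 = (3 : ℂ) ^ (-(2 : ℂ) / 3) / Complex.Gamma (2 / 3))
    (h0' : Ai' 0 = -((3 : ℂ) ^ (-(1 : ℂ) / 3)) / Complex.Gamma (1 / 3))
    (hreal : (Ai 1).im = 0) :
    ∃ C : ℝ, ∀ v ∈ quarterSector, Ai (v ^ 2) = C * airyProfile v := by
  obtain ⟨p, p', hp, hp', hp0, hinit, M, hM⟩ := exists_bounded_airy_solution
  have hprop : ∀ z, p z * Ai' z - p' z * Ai z = 0 := by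
    have hd : ∀ z, HasDerivAt (fun z => p z * Ai' z - p' z * Ai z) 0 z := fun z => by
      refine (((hp z).mul (hA' z)).sub ((hp' z).mul (hA z))).congr_deriv ?_
      ring
    intro z
    rw [is_const_of_deriv_eq_zero (fun z => (hd z).differentiableAt) (fun z => (hd z).deriv) z 0,
      h0, h0', hinit, sub_self]
  obtain ⟨x, hx, hpx⟩ : ∃ x : ℝ, 0 < x ∧ p ((x : ℂ) ^ 2) ≠ 0 := by
    have hc : ContinuousAt (fun x : ℝ => p ((x : ℂ) ^ 2)) 0 :=
      (hp _).continuousAt.comp (f := fun x : ℝ => (x : ℂ) ^ 2) (by fun_prop)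
    have hev := (hc.eventually_ne (y := 0) (by simpa using hp0)).filter_mono
      (nhdsWithin_le_nhds (s := Ioi 0))
    obtain ⟨x, h1, h2⟩ := (hev.and self_mem_nhdsWithin).exists
    exact ⟨x, h2, h1⟩
  have hxm := ofReal_mem_quarterSector hx
  have hW : ∀ v ∈ quarterSector,
      airyProfile v * Ai' (v ^ 2) - airyProfileDeriv v * Ai (v ^ 2) = 0 := by
    intro v hv
    rw [wronskian_airyProfile_const hA hA' hv hxm]
    refine (mul_eq_zero.1 ?_).resolve_left hpx
    linear_combination airyProfile x * hprop ((x : ℂ) ^ 2) +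
      Ai ((x : ℂ) ^ 2) * wronskian_airyProfile_eq_zero hp hp' hM hxm
  have hquot : ∀ v ∈ quarterSector, HasDerivAt (fun v => Ai (v ^ 2) / airyProfile v) 0 v := by
    intro v hv
    refine (((hA (v ^ 2)).comp v (hasDerivAt_pow 2 v)).div (hasDerivAt_airyProfile hv)
      (airyProfile_ne_zero hv)).congr_deriv ?_
    rw [div_eq_zero_iff]
    left
    simp only [Function.comp]
    push_cast
    linear_combination 2 * v * hW v hv
  have h1 : (1 : ℂ) ∈ quarterSector := by simpa using ofReal_mem_quarterSector one_pos
  have hconst : ∀ v ∈ quarterSector, Ai (v ^ 2) = Ai 1 / airyProfile 1 * airyProfile v := by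
    intro v hv
    have h := isOpen_quarterSector.is_const_of_deriv_eq_zero isPreconnected_quarterSector
      (fun v hv => (hquot v hv).differentiableAt.differentiableWithinAt)
      (fun v hv => (hquot v hv).deriv) hv h1
    rw [one_pow] at h
    rw [← h, div_mul_cancel₀ _ (airyProfile_ne_zero hv)]
  have hC : starRingEnd ℂ (Ai 1 / airyProfile 1) = Ai 1 / airyProfile 1 := by
    rw [map_div₀, ← airyProfile_conj h1, map_one, Complex.conj_eq_iff_im.2 hreal]
  obtain ⟨C, hCr⟩ := Complex.conj_eq_iff_real.1 hC
  exact ⟨C, fun v hv => by rw [hconst v hv, hCr]⟩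

/-! ### The phase of the Airy function -/

lemma mul_exp_mem_quarterSector {s : ℝ} (hs : 0 < s) :
    (s : ℂ) * Complex.exp ((-(Real.pi / 6) : ℝ) * Complex.I) ∈ quarterSector := by
  change |Complex.im _| < Complex.re _
  rw [Complex.re_ofReal_mul, Complex.im_ofReal_mul, Complex.exp_ofReal_mul_I_re,
    Complex.exp_ofReal_mul_I_im, Real.cos_neg, Real.sin_neg, Real.cos_pi_div_six,
    Real.sin_pi_div_six, abs_mul, abs_of_pos hs, abs_neg, abs_of_pos (by norm_num : (0 : ℝ) < 1 / 2)]
  have : 1 < √3 := Real.lt_sqrt_of_sq_lt (by norm_num)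
  gcongr

lemma conj_mem_quarterSector {v : ℂ} (hv : v ∈ quarterSector) :
    starRingEnd ℂ v ∈ quarterSector := by
  have h : |v.im| < v.re := hv
  simpa [quarterSector] using h

lemma Aminus_eq_conj_Aplus {Ai : ℂ → ℂ} {C : ℝ}
    (hC : ∀ v ∈ quarterSector, Ai (v ^ 2) = C * airyProfile v) {s : ℝ} (hs : 0 < s) :
    Aminus Ai ((s ^ 2 : ℝ) : ℂ) = starRingEnd ℂ (Aplus Ai ((s ^ 2 : ℝ) : ℂ)) := by
  have hv := mul_exp_mem_quarterSector hs
  set v : ℂ := (s : ℂ) * Complex.exp ((-(Real.pi / 6) : ℝ) * Complex.I) with hvdef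
  have hv2 : Complex.exp (-(Real.pi / 3 : ℂ) * Complex.I) * ((s ^ 2 : ℝ) : ℂ) = v ^ 2 := by
    rw [hvdef, mul_pow, ← Complex.exp_nat_mul]
    push_cast
    rw [mul_comm]
    ring_nf
  have he : Complex.exp ((Real.pi / 3 : ℂ) * Complex.I) =
      starRingEnd ℂ (Complex.exp (-(Real.pi / 3 : ℂ) * Complex.I)) := by
    rw [← Complex.exp_conj]
    congr 1
    simp [Complex.conj_ofNat]
  have hc2 : Complex.exp ((Real.pi / 3 : ℂ) * Complex.I) * ((s ^ 2 : ℝ) : ℂ) =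
      (starRingEnd ℂ v) ^ 2 := by
    rw [he, ← map_pow, ← hv2, map_mul, Complex.conj_ofReal]
  rw [Aminus, Aplus, hc2, hv2, hC _ hv, hC _ (conj_mem_quarterSector hv), airyProfile_conj hv, he,
    map_mul, map_mul, Complex.conj_ofReal]

lemma Aplus_eq {Ai : ℂ → ℂ} {C : ℝ}
    (hC : ∀ v ∈ quarterSector, Ai (v ^ 2) = C * airyProfile v) {s : ℝ} (hs : 0 < s) :
    ∃ r : ℝ, Aplus Ai ((s ^ 2 : ℝ) : ℂ) =
      r * Complex.exp ((2 / 3 * s ^ 3 - Real.pi / 4 : ℝ) * Complex.I) *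
        phaseLaplace 0 (4 / 3 * s ^ 3)⁻¹ := by
  have hv := mul_exp_mem_quarterSector hs
  set v : ℂ := (s : ℂ) * Complex.exp ((-(Real.pi / 6) : ℝ) * Complex.I) with hvdef
  have hv2 : Complex.exp (-(Real.pi / 3 : ℂ) * Complex.I) * ((s ^ 2 : ℝ) : ℂ) = v ^ 2 := by
    rw [hvdef, mul_pow, ← Complex.exp_nat_mul]
    push_cast
    rw [mul_comm]
    ring_nf
  have hv3 : v ^ 3 = -(Complex.I * (s ^ 3 : ℝ)) := by
    rw [hvdef, mul_pow, ← Complex.exp_nat_mul,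
      show ((3 : ℕ) : ℂ) * ((-(Real.pi / 6) : ℝ) * Complex.I) = -Real.pi / 2 * Complex.I by
        push_cast; ring, Complex.exp_neg_pi_div_two_mul_I]
    push_cast
    ring
  have ht : 0 < 4 / 3 * s ^ 3 := by positivity
  refine ⟨C * (4 / 3 * s ^ 3) ^ (-(1 / 6) : ℝ), ?_⟩
  rw [Aplus, hv2, hC _ hv, airyProfile, hv3,
    show 4 / 3 * -(Complex.I * ((s ^ 3 : ℝ) : ℂ)) = -(Complex.I * (4 / 3 * s ^ 3 : ℝ)) by
      push_cast; ring, shiftedLaplace_neg_I_mul ht,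
    show ((2 / 3 * s ^ 3 - Real.pi / 4 : ℝ) : ℂ) * Complex.I = -(Real.pi / 3 : ℂ) * Complex.I +
      (-(2 / 3) * -(Complex.I * ((s ^ 3 : ℝ) : ℂ)) + (Real.pi / 12 : ℝ) * Complex.I) by
      push_cast; ring, Complex.exp_add, Complex.exp_add, Complex.ofReal_mul]
  ring

/-- The phase function `L` is determined by `airyPhase` up to a multiple of `2π`. -/
lemma exists_int_Bfun_add_airyPhase {Ai : ℂ → ℂ} {C : ℝ}
    (hC : ∀ v ∈ quarterSector, Ai (v ^ 2) = C * airyProfile v) {L : ℝ → ℝ}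
    (hne : ∀ w : ℝ, Aplus Ai w ≠ 0)
    (hL : ∀ w : ℝ, Complex.exp (-(L w : ℂ) * Complex.I) = -(Aminus Ai w) / (Aplus Ai w))
    {u : ℝ} (hu : 0 < u) :
    ∃ n : ℤ, Bfun L u + 2 * airyPhase (4 / 3 * u)⁻¹ = n * (2 * Real.pi) := by
  set s : ℝ := u ^ (1 / 3 : ℝ) with hsdef
  have hs : 0 < s := Real.rpow_pos_of_pos hu _
  have hs2 : s ^ 2 = u ^ ((2 : ℝ) / 3) := by
    rw [hsdef, ← Real.rpow_natCast, ← Real.rpow_mul hu.le]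
    norm_num
  have hs3 : s ^ 3 = u := by
    rw [hsdef, ← Real.rpow_natCast, ← Real.rpow_mul hu.le]
    norm_num
  obtain ⟨r, hr⟩ := Aplus_eq hC hs
  rw [hs3] at hr
  have h0 := hne (s ^ 2)
  have hr0 : (r : ℂ) ≠ 0 := fun h => h0 (by rw [hr, h, zero_mul, zero_mul])
  have hK0 : phaseLaplace 0 (4 / 3 * u)⁻¹ ≠ 0 := fun h => h0 (by rw [hr, h, mul_zero])
  have hchar := hL (s ^ 2)
  have hconj : starRingEnd ℂ (Complex.exp ((2 / 3 * u - Real.pi / 4 : ℝ) * Complex.I)) =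
      Complex.exp (-((2 / 3 * u - Real.pi / 4 : ℝ) * Complex.I)) := by
    rw [← Complex.exp_conj, map_mul, Complex.conj_ofReal, Complex.conj_I, mul_neg]
  have hexp : -(starRingEnd ℂ (Aplus Ai ((s ^ 2 : ℝ) : ℂ))) / Aplus Ai ((s ^ 2 : ℝ) : ℂ) =
      Complex.exp (Real.pi * Complex.I + (-((2 / 3 * u - Real.pi / 4 : ℝ) * Complex.I) +
        (-((2 / 3 * u - Real.pi / 4 : ℝ) * Complex.I) +
          (-(2 * airyPhase (4 / 3 * u)⁻¹ : ℝ) * Complex.I)))) := by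
    rw [Complex.exp_add, Complex.exp_add, Complex.exp_add, Complex.exp_pi_mul_I,
      ← conj_phaseLaplace_div, hr, map_mul, map_mul, Complex.conj_ofReal, hconj, Complex.exp_neg]
    have := Complex.exp_ne_zero ((2 / 3 * u - Real.pi / 4 : ℝ) * Complex.I)
    field_simp
  rw [Aminus_eq_conj_Aplus hC hs, hexp, Complex.exp_eq_exp_iff_exists_int] at hchar
  obtain ⟨n, hn⟩ := hchar
  refine ⟨n + 1, ?_⟩
  rw [Bfun, ← hs2]
  generalize airyPhase (4 / 3 * u)⁻¹ = p at hn ⊢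
  have him := congrArg Complex.im hn
  simp at him
  push_cast
  linarith

lemma Bfun_eq_airyPhase {Ai : ℂ → ℂ} {C : ℝ}
    (hC : ∀ v ∈ quarterSector, Ai (v ^ 2) = C * airyProfile v) {L : ℝ → ℝ}
    (hLc : Continuous L) (hL0 : L 0 = Real.pi / 3) (hne : ∀ w : ℝ, Aplus Ai w ≠ 0)
    (hL : ∀ w : ℝ, Complex.exp (-(L w : ℂ) * Complex.I) = -(Aminus Ai w) / (Aplus Ai w))
    {u : ℝ} (hu : 0 < u) :
    Bfun L u = -2 * airyPhase (4 / 3 * u)⁻¹ := by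
  have hBc : Continuous (Bfun L) := by
    have : Continuous fun u : ℝ => u ^ ((2 : ℝ) / 3) :=
      Real.continuous_rpow_const (by norm_num)
    unfold Bfun
    fun_prop
  have hB0 : Bfun L 0 = Real.pi / 6 := by
    rw [Bfun, Real.zero_rpow (by norm_num), hL0]
    ring
  have hpi := Real.pi_pos
  set D : ℝ → ℝ := fun u => Bfun L u + 2 * airyPhase (4 / 3 * u)⁻¹ with hD
  have hDint : ∀ u, 0 < u → D u = 0 ∨ 2 * Real.pi ≤ |D u| := by
    intro u hu
    obtain ⟨n, hn⟩ := exists_int_Bfun_add_airyPhase hC hne hL hu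
    have hn : D u = n * (2 * Real.pi) := hn
    rcases eq_or_ne n 0 with rfl | h
    · left
      simpa using hn
    · right
      rw [hn, abs_mul, abs_of_pos (by positivity : 0 < 2 * Real.pi)]
      have : (1 : ℝ) ≤ |(n : ℝ)| := by exact_mod_cast Int.one_le_abs h
      nlinarith
  have hDc : ContinuousOn (fun u => |D u|) (Ioi 0) := by
    refine (hBc.continuousOn.add (continuousOn_const.mul
      ((contDiff_airyPhase 0).continuous.comp_continuousOn
        (ContinuousOn.inv₀ (by fun_prop) fun u hu => ?_)))).abs
    have : 0 < u := hu
    positivity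
  obtain ⟨u₀, hu₀, hDu₀⟩ : ∃ u₀ : ℝ, 0 < u₀ ∧ |D u₀| < 2 * Real.pi := by
    have hev : ∀ᶠ u in 𝓝[>] (0 : ℝ), Bfun L u ∈ Ioo (-Real.pi) Real.pi :=
      (hBc.continuousAt.eventually_mem (Ioo_mem_nhds (by rw [hB0]; linarith)
        (by rw [hB0]; linarith))).filter_mono nhdsWithin_le_nhds
    obtain ⟨u₀, h1, h2⟩ := (hev.and self_mem_nhdsWithin).exists
    refine ⟨u₀, h2, ?_⟩
    have h3 := abs_lt.1 (abs_airyPhase_lt (4 / 3 * u₀)⁻¹)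
    rw [abs_lt]
    constructor <;> simp only [hD] <;> linarith [h1.1, h1.2, h3.1, h3.2]
  have hD0 : |D u₀| = 0 := by
    rcases hDint u₀ hu₀ with h | h
    · rw [h, abs_zero]
    · exact absurd hDu₀ h.not_gt
  suffices D u = 0 by
    simp only [hD] at this
    linarith
  refine (hDint u hu).resolve_right fun h => ?_
  obtain ⟨x, hx, hxD⟩ := isPreconnected_Ioi.intermediate_value (Set.mem_Ioi.2 hu₀)
    (Set.mem_Ioi.2 hu) hDc (show Real.pi ∈ Icc (|D u₀|) (|D u|) from
      ⟨by rw [hD0]; exact hpi.le, by linarith⟩)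
  have hxD : |D x| = Real.pi := hxD
  rcases hDint x hx with h' | h'
  · rw [h', abs_zero] at hxD
    exact hpi.ne hxD
  · rw [hxD] at h'
    linarith

/-- A smooth function of `u⁻¹` vanishing at the origin has an asymptotic expansion in powers
of `u⁻¹`. -/
lemma exists_asymptotic_expansion_of_contDiff {β : ℝ → ℝ} (hβ : ∀ n : ℕ, ContDiff ℝ n β)
    (hβ0 : β 0 = 0) (n : ℕ) : ∃ C : ℝ, ∀ u : ℝ, 1 ≤ u →
      |β u⁻¹ - ∑ k ∈ Finset.Icc 1 n,
        iteratedDerivWithin k β (Icc 0 1) 0 / (k.factorial : ℝ) * u ^ (-(k : ℝ))| ≤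
          C * u ^ (-((n : ℝ) + 1)) := by
  obtain ⟨C, hC⟩ := exists_taylor_mean_remainder_bound (n := n) zero_le_one
    ((hβ (n + 1)).contDiffOn (s := Icc (0 : ℝ) 1))
  refine ⟨C, fun u hu => ?_⟩
  have hu0 : 0 < u := by linarith
  have h := hC u⁻¹ ⟨by positivity, inv_le_one_of_one_le₀ hu⟩
  rw [taylor_within_apply, Finset.sum_range_succ', iteratedDerivWithin_zero, hβ0, smul_zero,
    add_zero, Real.norm_eq_abs, sub_zero] at h
  have hsum : ∑ k ∈ Finset.Icc 1 n,
      iteratedDerivWithin k β (Icc 0 1) 0 / (k.factorial : ℝ) * u ^ (-(k : ℝ)) =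
      ∑ k ∈ Finset.range n, (((k + 1).factorial : ℝ)⁻¹ * u⁻¹ ^ (k + 1)) •
        iteratedDerivWithin (k + 1) β (Icc 0 1) 0 := by
    rw [Finset.range_eq_Ico, Finset.sum_Ico_add' (fun k => ((k.factorial : ℝ)⁻¹ * u⁻¹ ^ k) •
      iteratedDerivWithin k β (Icc 0 1) 0)]
    refine Finset.sum_congr (by ext; simp) fun k _ => ?_
    rw [Real.rpow_neg hu0.le, Real.rpow_natCast, inv_pow, smul_eq_mul]
    ring
  rw [hsum, Real.rpow_neg hu0.le, show (n : ℝ) + 1 = ((n + 1 : ℕ) : ℝ) by push_cast; rfl,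
    Real.rpow_natCast, ← inv_pow]
  exact h

end AiryAsymptotics

/-- the function `B(u) = (4/3)u + π/2 − L(u^{2/3})` admits an asymptotic
expansion `B(u) ~ Σ_{k≥1} b_k u^{-k}` as `u → +∞`, with `b₁ > 0`. -/
theorem B_asymptotic_expansion
    (Ai : ℂ → ℂ)
    (hAi_diff : Differentiable ℂ Ai)
    (hAi_diff' : Differentiable ℂ (deriv Ai))
    (hAi_ode : ∀ z : ℂ, deriv (deriv Ai) z = z * Ai z)
    (hAi_zero : Ai 0 = (3 : ℂ) ^ (-(2 : ℂ)/3) / Complex.Gamma (2/3))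
    (hAi_zero' : deriv Ai 0 = -((3 : ℂ) ^ (-(1 : ℂ)/3)) / Complex.Gamma (1/3))
    (hAi_real : ∀ x : ℝ, (Ai x).im = 0)
    (L : ℝ → ℝ)
    (hL_cont : Continuous L)
    (hL_zero : L 0 = Real.pi / 3)
    (hAp_ne : ∀ w : ℝ, Aplus Ai w ≠ 0)
    (hL_char : ∀ w : ℝ, Complex.exp (-(L w : ℂ) * Complex.I) = -(Aminus Ai w) / (Aplus Ai w)) :
    ∃ b : ℕ → ℝ, 0 < b 1 ∧
      ∀ n : ℕ, 1 ≤ n → ∃ C : ℝ, ∀ u : ℝ, 1 ≤ u →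
        |Bfun L u - ∑ k ∈ Finset.Icc 1 n, b k * u ^ (-(k : ℝ))| ≤ C * u ^ (-((n : ℝ) + 1)) := by
  have hA : ∀ z, HasDerivAt Ai (deriv Ai z) z := fun z => (hAi_diff z).hasDerivAt
  have hA' : ∀ z, HasDerivAt (deriv Ai) (z * Ai z) z := fun z =>
    hAi_ode z ▸ (hAi_diff' z).hasDerivAt
  obtain ⟨C, hC⟩ := exists_eq_mul_airyProfile hA hA' hAi_zero hAi_zero'
    (by simpa using hAi_real 1)
  obtain ⟨d, hd, hphase⟩ := exists_hasDerivAt_airyPhase_zero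
  let β : ℝ → ℝ := fun s => -2 * airyPhase (3 / 4 * s)
  have hβ : ∀ n : ℕ, ContDiff ℝ n β := fun n =>
    contDiff_const.mul ((contDiff_airyPhase n).comp (contDiff_const.mul contDiff_id))
  have hβ0 : β 0 = 0 := by simp [β, airyPhase_zero]
  have hβ' : HasDerivAt β (-2 * (d * (3 / 4 * 1))) 0 := by
    refine HasDerivAt.const_mul _ (HasDerivAt.comp (h₂ := airyPhase) (0 : ℝ) ?_
      ((hasDerivAt_id (0 : ℝ)).const_mul (3 / 4)))
    simpa using hphase
  refine ⟨fun k => iteratedDerivWithin k β (Set.Icc 0 1) 0 / (k.factorial : ℝ), ?_, fun n _ => ?_⟩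
  · have hu : UniqueDiffWithinAt ℝ (Set.Icc (0 : ℝ) 1) 0 :=
      uniqueDiffOn_Icc one_pos 0 (Set.left_mem_Icc.2 zero_le_one)
    simp only [iteratedDerivWithin_one, hβ'.hasDerivWithinAt.derivWithin hu, Nat.factorial_one,
      Nat.cast_one, div_one]
    linarith
  · obtain ⟨K, hK⟩ := exists_asymptotic_expansion_of_contDiff hβ hβ0 n
    refine ⟨K, fun u hu => ?_⟩
    have hB : Bfun L u = β u⁻¹ := by
      rw [Bfun_eq_airyPhase hC hL_cont hL_zero hAp_ne hL_char (by linarith), mul_inv]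
      norm_num [β]
    rw [hB]
    exact hK u hu
end

section
/- (Airy–Poisson summation formula) For every φ ∈ C_c^∞(ℝ), lim_{M→∞} Σ_{N=−M}^{M} ∫_ℝ e^{−iN L(ω)} φ(ω) dω = 2π Σ_{k≥1} φ(ω_k)/L'(ω_k), where the right-hand side is a finite sum since φ has compact support and ω_k → ∞. -/
open Real Complex Filter MeasureTheory

open scoped FourierTransform

/-- A smooth function on `ℝ` with positive derivative is an open embedding. -/
lemma isOpenEmbedding_of_deriv_pos {l : ℝ → ℝ} (hl : ContDiff ℝ (⊤ : ℕ∞) l)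
    (hl' : ∀ x, 0 < deriv l x) : Topology.IsOpenEmbedding l :=
  .of_continuous_injective_isOpenMap hl.continuous (strictMono_of_deriv_pos hl').injective <|
    isOpenMap_of_hasStrictDerivAt
      (fun x => hl.contDiffAt.hasStrictDerivAt (by simp)) fun x => ne_of_gt (hl' x)

/-- Transporting a compactly supported smooth function along a smooth open embedding of `ℝ`
and extending by zero gives a compactly supported smooth function. -/
lemma contDiff_extend {l : ℝ → ℝ} (hl : ContDiff ℝ (⊤ : ℕ∞) l) (hl' : ∀ x, 0 < deriv l x)
    {g : ℝ → ℂ} (hg : ContDiff ℝ (⊤ : ℕ∞) g) (hgc : HasCompactSupport g) :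
    ContDiff ℝ (⊤ : ℕ∞) (Function.extend l g 0) ∧
      HasCompactSupport (Function.extend l g 0) := by
  have he := isOpenEmbedding_of_deriv_pos hl hl'
  have hzero : ∀ u ∉ l '' tsupport g, Function.extend l g 0 u = 0 := by
    intro u hu
    by_cases h : ∃ x, l x = u
    · obtain ⟨x, rfl⟩ := h
      rw [he.injective.extend_apply]
      exact image_eq_zero_of_notMem_tsupport fun hx => hu ⟨x, hx, rfl⟩
    · rw [Function.extend_apply' _ _ _ h, Pi.zero_apply]
  have hK : IsCompact (l '' tsupport g) := hgc.isCompact.image hl.continuous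
  refine ⟨contDiff_iff_contDiffAt.2 fun u => ?_, HasCompactSupport.intro hK hzero⟩
  by_cases hu : u ∈ l '' tsupport g
  · obtain ⟨x, -, rfl⟩ := hu
    let e := he.toOpenPartialHomeomorph l
    have hx : e.symm (l x) = x := e.left_inv (Set.mem_univ x)
    have hsymm : ContDiffAt ℝ (⊤ : ℕ∞) e.symm (l x) := by
      refine e.contDiffAt_symm_deriv (hl' x).ne' ⟨x, trivial, rfl⟩ ?_ hl.contDiffAt
      rw [hx]
      exact (hl.differentiable (by simp) x).hasDerivAt
    refine (hg.contDiffAt.comp (l x) hsymm).congr_of_eventuallyEq ?_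
    filter_upwards [he.isOpen_range.mem_nhds ⟨x, rfl⟩]
    rintro _ ⟨y, rfl⟩
    have hy : e.symm (l y) = y := e.left_inv (Set.mem_univ y)
    rw [he.injective.extend_apply, Function.comp_apply, hy]
  · refine contDiffAt_const (c := (0 : ℂ)) |>.congr_of_eventuallyEq ?_
    filter_upwards [hK.isClosed.isOpen_compl.mem_nhds hu] with v hv using hzero v hv

/-- The Fourier transform of the pushforward of `φ(x) dx` under `l`. -/
lemma fourier_extend {l : ℝ → ℝ} (hl : ContDiff ℝ (⊤ : ℕ∞) l) (hl' : ∀ x, 0 < deriv l x)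
    (φ : ℝ → ℂ) (t : ℝ) :
    𝓕 (Function.extend l (fun x => φ x / ((deriv l x : ℝ) : ℂ)) 0) t =
      ∫ x, Complex.exp (-(2 * π * t * l x : ℂ) * I) * φ x := by
  have he := isOpenEmbedding_of_deriv_pos hl hl'
  rw [fourier_real_eq_integral_exp_smul, ← setIntegral_eq_integral_of_forall_compl_eq_zero
    (s := l '' Set.univ), integral_image_eq_integral_abs_deriv_smul (f' := deriv l) .univ
    (fun x _ => (hl.differentiable (by simp) x).hasDerivAt.hasDerivWithinAt)
    he.injective.injOn, setIntegral_univ]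
  · congr 1 with x
    have : ((deriv l x : ℝ) : ℂ) ≠ 0 := by exact_mod_cast (hl' x).ne'
    rw [he.injective.extend_apply, abs_of_pos (hl' x), real_smul, smul_eq_mul]
    rw [show ((-2 * π * l x * t : ℝ) : ℂ) * I = -(2 * π * t * l x : ℂ) * I by push_cast; ring]
    field_simp
  · intro u hu
    rw [Function.extend_apply' _ _ _ (by simpa using hu), Pi.zero_apply, smul_zero]

/-- Poisson summation after a smooth change of variables. -/
lemma hasSum_integral_exp_comp {l : ℝ → ℝ} (hl : ContDiff ℝ (⊤ : ℕ∞) l)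
    (hl' : ∀ x, 0 < deriv l x) {φ : ℝ → ℂ} (hφ : ContDiff ℝ (⊤ : ℕ∞) φ)
    (hφc : HasCompactSupport φ) :
    HasSum (fun N : ℤ => ∫ x, Complex.exp (-(2 * π * N * l x : ℂ) * I) * φ x)
      (∑' n : ℤ, Function.extend l (fun x => φ x / ((deriv l x : ℝ) : ℂ)) 0 (n : ℝ)) := by
  have hd : ContDiff ℝ (⊤ : ℕ∞) (deriv l) := ((contDiff_succ_iff_deriv (n := (⊤ : ℕ∞))).1 hl).2.2
  have hg : ContDiff ℝ (⊤ : ℕ∞) (fun x => φ x / ((deriv l x : ℝ) : ℂ)) := by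
    simp_rw [div_eq_mul_inv]
    exact hφ.mul ((Complex.ofRealCLM.contDiff.comp hd).inv
      fun x => by simpa using (hl' x).ne')
  have hgc : HasCompactSupport (fun x => φ x / ((deriv l x : ℝ) : ℂ)) := by
    simp_rw [div_eq_mul_inv]
    exact hφc.mul_right
  obtain ⟨hs, hc⟩ := contDiff_extend hl hl' hg hgc
  let f : SchwartzMap ℝ ℂ := hc.toSchwartzMap hs
  have hsum : Summable fun n : ℤ => 𝓕 (f : ℝ → ℂ) n :=
    summable_of_isBigO (Real.summable_abs_int_rpow one_lt_two)
      (((𝓕 f).isBigO_cocompact_rpow (-2)).comp_tendsto Int.tendsto_coe_cofinite)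
  have hP := f.tsum_eq_tsum_fourier 0
  simp only [zero_add, QuotientAddGroup.mk_zero, fourier_eval_zero, mul_one] at hP
  have hF : ∀ N : ℤ, 𝓕 (f : ℝ → ℂ) N =
      ∫ x, Complex.exp (-(2 * π * N * l x : ℂ) * I) * φ x := fun N => by
    simpa using! fourier_extend hl hl' φ N
  simp_rw [← hF]
  exact hP ▸ hsum.hasSum

/-- The Wronskian of two solutions of `y'' = -x y` on the real line is constant. -/
lemma wronskian_eq {y₁ y₁' y₂ y₂' : ℝ → ℂ}
    (h₁ : ∀ x, HasDerivAt y₁ (y₁' x) x) (h₁' : ∀ x : ℝ, HasDerivAt y₁' (-x * y₁ x) x)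
    (h₂ : ∀ x, HasDerivAt y₂ (y₂' x) x) (h₂' : ∀ x : ℝ, HasDerivAt y₂' (-x * y₂ x) x) (x : ℝ) :
    y₁ x * y₂' x - y₁' x * y₂ x = y₁ 0 * y₂' 0 - y₁' 0 * y₂ 0 := by
  have hd : ∀ x, HasDerivAt (fun x => y₁ x * y₂' x - y₁' x * y₂ x) 0 x := fun x => by
    exact (((h₁ x).mul (h₂' x)).sub ((h₁' x).mul (h₂ x))).congr_deriv (by ring)
  exact is_const_of_deriv_eq_zero (fun x => (hd x).differentiableAt) (fun x => (hd x).deriv) x 0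

/-- A solution of `y'' = -x y` vanishing to second order at `0` is zero wherever some other
solution has no zeros. -/
lemma eq_zero_of_solution {y y' p p' : ℝ → ℂ}
    (hy : ∀ x, HasDerivAt y (y' x) x) (hy' : ∀ x : ℝ, HasDerivAt y' (-x * y x) x)
    (hp : ∀ x, HasDerivAt p (p' x) x) (hp' : ∀ x : ℝ, HasDerivAt p' (-x * p x) x)
    (hp0 : ∀ x, p x ≠ 0) (h0 : y 0 = 0) (h0' : y' 0 = 0) (x : ℝ) : y x = 0 := by
  have hd : ∀ x, HasDerivAt (fun x => y x / p x) 0 x := fun x => by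
    have hW := wronskian_eq hy hy' hp hp' x
    rw [h0, h0', zero_mul, zero_mul, sub_zero] at hW
    exact ((hy x).div (hp x) (hp0 x)).congr_deriv (by rw [← neg_sub, hW, neg_zero, zero_div])
  have := is_const_of_deriv_eq_zero (fun x => (hd x).differentiableAt) (fun x => (hd x).deriv) x 0
  simpa [h0, hp0 x] using this

/-- If `F'' = z F` and `a³ = -1`, then `x ↦ c F(a x)` solves `y'' = -x y` on the real line. -/
lemma hasDerivAt_rotate {F : ℂ → ℂ} (hF : Differentiable ℂ F) (hF' : Differentiable ℂ (deriv F))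
    (hode : ∀ z : ℂ, deriv (deriv F) z = z * F z) {a : ℂ} (ha : a ^ 3 = -1) (c : ℂ) (x : ℝ) :
    HasDerivAt (fun x : ℝ => c * F (a * x)) (c * (a * deriv F (a * x))) x ∧
      HasDerivAt (fun x : ℝ => c * (a * deriv F (a * x))) (-x * (c * F (a * x))) x := by
  have hlin : HasDerivAt (fun x : ℝ => a * (x : ℂ)) a x := by
    simpa using! (Complex.ofRealCLM.hasDerivAt (x := x)).const_mul a
  constructor
  · exact (((hF (a * x)).hasDerivAt.comp x hlin).const_mul c).congr_deriv (by ring)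
  · refine ((((hF' (a * x)).hasDerivAt.comp x hlin).const_mul a).const_mul c).congr_deriv ?_
    rw [hode]
    linear_combination (x * c * F (a * x)) * ha

/-- A phase `L` with `e^{-iL} = -q/p`, where `p, q` are nonvanishing solutions of `y'' = -x y`,
is smooth with positive derivative as soon as the derivative is positive at one point. -/
lemma phase_contDiff_deriv_pos {p p' q q' : ℝ → ℂ}
    (hp : ∀ x, HasDerivAt p (p' x) x) (hp' : ∀ x : ℝ, HasDerivAt p' (-x * p x) x)
    (hq : ∀ x, HasDerivAt q (q' x) x) (hq' : ∀ x : ℝ, HasDerivAt q' (-x * q x) x)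
    (hpd : ContDiff ℝ (⊤ : ℕ∞) p) (hqd : ContDiff ℝ (⊤ : ℕ∞) q)
    (hp0 : ∀ x, p x ≠ 0) {L : ℝ → ℝ} (hL : Differentiable ℝ L)
    (hchar : ∀ x, Complex.exp (-(L x : ℂ) * I) = -(q x) / p x)
    {x₀ : ℝ} (hx₀ : 0 < deriv L x₀) :
    ContDiff ℝ (⊤ : ℕ∞) L ∧ ∀ x, 0 < deriv L x := by
  have hq0 : ∀ x, q x ≠ 0 := fun x h => by
    have := hchar x
    rw [h, neg_zero, zero_div] at this
    exact Complex.exp_ne_zero _ this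
  set C : ℂ := q 0 * p' 0 - q' 0 * p 0 with hC
  have hderiv : ∀ x, ((deriv L x : ℝ) : ℂ) = C / (I * (q x * p x)) := fun x => by
    have h1 : HasDerivAt (fun x => Complex.exp (-(L x : ℂ) * I))
        (Complex.exp (-(L x : ℂ) * I) * (-((deriv L x : ℝ) : ℂ) * I)) x :=
      (((hL x).hasDerivAt.ofReal_comp).neg.mul_const I).cexp
    have h2 := (hq x).neg.div (hp x) (hp0 x)
    have h3 := h1.unique (h2.congr_of_eventuallyEq (.of_forall hchar))
    have hW := wronskian_eq hq hq' hp hp' x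
    rw [← hC] at hW
    rw [hchar] at h3
    have hp0x := hp0 x
    have hq0x := hq0 x
    rw [eq_div_iff (by simp [hp0x, hq0x]), ← hW]
    simp only [Pi.neg_apply] at h3
    field_simp at h3
    linear_combination h3
  have hC0 : C ≠ 0 := fun h => by
    have := hderiv x₀
    rw [h, zero_div] at this
    exact hx₀.ne' (by exact_mod_cast this)
  have hsm : ContDiff ℝ (⊤ : ℕ∞) (deriv L) := by
    have : deriv L = fun x => (C / (I * (q x * p x))).re := by
      funext x
      rw [← hderiv, ofReal_re]
    rw [this]
    simp_rw [div_eq_mul_inv]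
    exact Complex.reCLM.contDiff.comp (contDiff_const.mul
      ((contDiff_const.mul (hqd.mul hpd)).inv fun x => by simp [hp0 x, hq0 x]))
  refine ⟨(contDiff_succ_iff_deriv (n := (⊤ : ℕ∞))).2 ⟨hL, by simp, hsm⟩, fun x => ?_⟩
  by_contra! hx
  obtain ⟨y, hy⟩ := mem_range_of_exists_le_of_exists_ge hsm.continuous ⟨x, hx⟩ ⟨x₀, hx₀.le⟩
  have := hderiv y
  rw [hy, ofReal_zero, eq_comm, div_eq_zero_iff] at this
  simp [hC0, hp0 y, hq0 y] at this

lemma exp_neg_pi_div_three_mul_I_pow_three :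
    Complex.exp (-(Real.pi / 3 : ℂ) * I) ^ 3 = -1 := by
  rw [← Complex.exp_nat_mul, show ((3 : ℕ) : ℂ) * (-(Real.pi / 3 : ℂ) * I) = -(Real.pi * I) by
    push_cast; ring, Complex.exp_neg, Complex.exp_pi_mul_I]
  norm_num

lemma exp_pi_div_three_mul_I_pow_three : Complex.exp ((Real.pi / 3 : ℂ) * I) ^ 3 = -1 := by
  rw [← Complex.exp_nat_mul, show ((3 : ℕ) : ℂ) * ((Real.pi / 3 : ℂ) * I) = Real.pi * I by
    push_cast; ring, Complex.exp_pi_mul_I]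

lemma exp_neg_add_exp_pi_div_three_mul_I :
    Complex.exp (-(Real.pi / 3 : ℂ) * I) + Complex.exp ((Real.pi / 3 : ℂ) * I) = 1 := by
  have h : 2 * Complex.cos (Real.pi / 3 : ℂ) = 1 := by
    have : Complex.cos (Real.pi / 3 : ℂ) = ((Real.cos (Real.pi / 3) : ℝ) : ℂ) := by push_cast; rfl
    rw [this, Real.cos_pi_div_three]
    norm_num
  rw [← h, Complex.two_cos]
  ring

/-- The connection formula `Ai(-w) = A₊(w) + A₋(w)`. -/
lemma Aplus_add_Aminus {Ai : ℂ → ℂ} (hd : Differentiable ℂ Ai)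
    (hd' : Differentiable ℂ (deriv Ai)) (hode : ∀ z : ℂ, deriv (deriv Ai) z = z * Ai z)
    (hne : ∀ w : ℝ, Aplus Ai w ≠ 0) (w : ℝ) : Aplus Ai w + Aminus Ai w = Ai (-w : ℝ) := by
  unfold Aplus Aminus at *
  have hp3 := exp_neg_pi_div_three_mul_I_pow_three
  have hq3 := exp_pi_div_three_mul_I_pow_three
  have hsum := exp_neg_add_exp_pi_div_three_mul_I
  set a := Complex.exp (-(Real.pi / 3 : ℂ) * I)
  set b := Complex.exp ((Real.pi / 3 : ℂ) * I)
  have hab : a * b = 1 := by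
    rw [← Complex.exp_add, neg_mul, neg_add_cancel, Complex.exp_zero]
  have hP := hasDerivAt_rotate hd hd' hode hp3 a
  have hQ := hasDerivAt_rotate hd hd' hode hq3 b
  have hR := hasDerivAt_rotate hd hd' hode (show (-1 : ℂ) ^ 3 = -1 by norm_num) 1
  have key := eq_zero_of_solution
    (y := fun x : ℝ => a * Ai (a * x) + b * Ai (b * x) - 1 * Ai (-1 * x))
    (fun x => (((hP x).1.add (hQ x).1).sub (hR x).1))
    (fun x => (((hP x).2.add (hQ x).2).sub (hR x).2).congr_deriv (by ring))
    (fun x => (hP x).1) (fun x => (hP x).2) hne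
    (by
      simp only [ofReal_zero, mul_zero]
      linear_combination Ai 0 * hsum)
    (by
      simp only [ofReal_zero, mul_zero]
      linear_combination deriv Ai 0 * ((a + b + 1) * hsum - 2 * hab)) w
  rw [one_mul, neg_one_mul] at key
  push_cast
  exact sub_eq_zero.1 key

/-- Airy–Poisson summation formula: for every `φ ∈ C_c^∞(ℝ)`,
`lim_{M→∞} Σ_{N=−M}^{M} ∫ e^{−iN L(ω)} φ(ω) dω = 2π Σ_{k≥1} φ(ω_k)/L'(ω_k)`. -/
theorem airy_poisson_summation
    (Ai : ℂ → ℂ)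
    (hAi_diff : Differentiable ℂ Ai)
    (hAi_diff' : Differentiable ℂ (deriv Ai))
    (hAi_ode : ∀ z : ℂ, deriv (deriv Ai) z = z * Ai z)
    (hAi_zero : Ai 0 = (3 : ℂ) ^ (-(2 : ℂ)/3) / Complex.Gamma (2/3))
    (hAi_zero' : deriv Ai 0 = -((3 : ℂ) ^ (-(1 : ℂ)/3)) / Complex.Gamma (1/3))
    (hAi_real : ∀ x : ℝ, (Ai x).im = 0)
    (ω : ℕ → ℝ)
    (hω_pos : 0 < ω 1)
    (hω_mono : StrictMonoOn ω {k | 1 ≤ k})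
    (hω_tendsto : Tendsto ω atTop atTop)
    (hAi_zeros : ∀ x : ℝ, Ai x = 0 ↔ ∃ k : ℕ, 1 ≤ k ∧ x = -ω k)
    (L : ℝ → ℝ)
    (hL_diff : Differentiable ℝ L)
    (hL_zero : L 0 = Real.pi / 3)
    (hAp_ne : ∀ w : ℝ, Aplus Ai w ≠ 0)
    (hL_char : ∀ w : ℝ, Complex.exp (-(L w : ℂ) * Complex.I) = -(Aminus Ai w) / (Aplus Ai w))
    (hL'_pos : ∀ k : ℕ, 1 ≤ k → 0 < deriv L (ω k)) :
    ∀ φ : ℝ → ℂ, ContDiff ℝ (⊤ : ℕ∞) φ → HasCompactSupport φ →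
      Tendsto
        (fun M : ℕ => ∑ N ∈ Finset.Icc (-(M : ℤ)) (M : ℤ),
          ∫ w : ℝ, Complex.exp (-(N : ℂ) * (L w : ℂ) * Complex.I) * φ w)
        atTop
        (nhds ((2 * Real.pi : ℝ) * ∑' k : ℕ, φ (ω (k + 1)) / ((deriv L (ω (k + 1)) : ℝ) : ℂ))) := by
  intro φ hφ hφc
  obtain ⟨hLs, hLpos⟩ : ContDiff ℝ (⊤ : ℕ∞) L ∧ ∀ x, 0 < deriv L x := by
    have hrot := @hasDerivAt_rotate Ai hAi_diff hAi_diff' hAi_ode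
    have hsm : ∀ a c : ℂ, ContDiff ℝ (⊤ : ℕ∞) (fun x : ℝ => c * Ai (a * x)) := fun a c =>
      contDiff_const.mul ((hAi_diff.contDiff.restrict_scalars ℝ).comp
        (contDiff_const.mul Complex.ofRealCLM.contDiff))
    exact phase_contDiff_deriv_pos
      (fun x => (hrot exp_neg_pi_div_three_mul_I_pow_three _ x).1)
      (fun x => (hrot exp_neg_pi_div_three_mul_I_pow_three _ x).2)
      (fun x => (hrot exp_pi_div_three_mul_I_pow_three _ x).1)
      (fun x => (hrot exp_pi_div_three_mul_I_pow_three _ x).2)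
      (hsm _ _) (hsm _ _) hAp_ne hL_diff hL_char (hL'_pos 1 le_rfl)
  have hphase : ∀ w : ℝ, (∃ n : ℤ, L w = n * (2 * π)) ↔ ∃ k : ℕ, w = ω (k + 1) := fun w => by
    have h1 : (∃ n : ℤ, L w = n * (2 * π)) ↔ Complex.exp (-(L w : ℂ) * I) = 1 := by
      rw [neg_mul, Complex.exp_neg, inv_eq_one, Complex.exp_eq_one_iff]
      refine exists_congr fun n => ?_
      rw [← mul_assoc (n : ℂ) (2 * π) I, mul_left_inj' I_ne_zero]
      norm_cast
    have h2 : (∃ k : ℕ, w = ω (k + 1)) ↔ Ai (-w : ℝ) = 0 := by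
      rw [hAi_zeros]
      constructor
      · rintro ⟨k, rfl⟩
        exact ⟨k + 1, by omega, rfl⟩
      · rintro ⟨k, hk, h⟩
        exact ⟨k - 1, by rw [Nat.sub_add_cancel hk]; exact neg_injective h⟩
    rw [h1, h2, hL_char, div_eq_one_iff_eq (hAp_ne w),
      ← Aplus_add_Aminus hAi_diff hAi_diff' hAi_ode hAp_ne, neg_eq_iff_add_eq_zero, add_comm]
  have hl : ContDiff ℝ (⊤ : ℕ∞) (fun x => L x / (2 * π)) := hLs.div_const _
  have hdl : ∀ x, deriv (fun x => L x / (2 * π)) x = deriv L x / (2 * π) := fun x =>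
    deriv_div_const _
  have hdl_pos : ∀ x, 0 < deriv (fun x => L x / (2 * π)) x := fun x => by
    rw [hdl]
    exact div_pos (hLpos x) two_pi_pos
  have hinj := (isOpenEmbedding_of_deriv_pos hl hdl_pos).injective
  have hsum := hasSum_integral_exp_comp hl hdl_pos hφ hφc
  have hω : ∀ k : ℕ, ∃ n : ℤ, L (ω (k + 1)) / (2 * π) = n := fun k => by
    obtain ⟨n, hn⟩ := (hphase _).2 ⟨k, rfl⟩
    exact ⟨n, by rw [hn, mul_div_cancel_right₀ _ two_pi_pos.ne']⟩
  choose ν hν using hω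
  have hν_inj : Function.Injective ν := fun j k h => by
    have h1 := hinj (a₁ := ω (j + 1)) (a₂ := ω (k + 1)) ((hν j).trans (h ▸ (hν k).symm))
    simpa using hω_mono.injOn (by simp) (by simp) h1
  have hsupp : Function.support (fun n : ℤ => Function.extend (fun x => L x / (2 * π))
      (fun x => φ x / ((deriv (fun x => L x / (2 * π)) x : ℝ) : ℂ)) 0 (n : ℝ)) ⊆
      Set.range ν := by
    intro n hn
    by_contra hnot
    refine hn (Function.extend_apply' _ _ _ ?_)
    rintro ⟨w, hw⟩
    obtain ⟨k, rfl⟩ := (hphase w).1 ⟨n, (div_eq_iff two_pi_pos.ne').1 hw⟩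
    exact hnot ⟨k, by exact_mod_cast (hν k).symm.trans hw⟩
  have hval : ∑' n : ℤ, Function.extend (fun x => L x / (2 * π))
      (fun x => φ x / ((deriv (fun x => L x / (2 * π)) x : ℝ) : ℂ)) 0 (n : ℝ) =
      (2 * π : ℝ) * ∑' k : ℕ, φ (ω (k + 1)) / ((deriv L (ω (k + 1)) : ℝ) : ℂ) := by
    rw [← hν_inj.tsum_eq hsupp, ← tsum_mul_left]
    refine tsum_congr fun k => ?_
    rw [← hν k, hinj.extend_apply (f := fun x => L x / (2 * π)), hdl]
    push_cast
    rw [div_div_eq_mul_div, mul_comm, mul_div_assoc]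
  rw [hval] at hsum
  refine (hsum.comp Finset.tendsto_Icc_neg).congr fun M => ?_
  refine Finset.sum_congr rfl fun N _ => integral_congr_ae (.of_forall fun w => ?_)
  have : (-(2 * π * N * (L w / (2 * π) : ℝ)) : ℂ) = -N * L w := by
    have := pi_ne_zero
    push_cast
    field_simp
  simp only [this]
end
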